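/- Let P be a simple rectilinear polygon with 2n vertices (n≥1), alternating between initial vertices V_0 and terminal vertices V_1 along the boundary, with all vertical-edge x-coordinates distinct and all horizontal-edge y-coordinates distinct. Then the closed region bounded by P can be partitioned into exactly n axis-parallel rectangles. -/

import Mathlib

/-- The closed axis-parallel rectangle with diagonal vertices `v` and `w`. -/
def rect (v w : ℝ × ℝ) : Set (ℝ × ℝ) :=
  Set.Icc (min v.1 w.1) (max v.1 w.1) ×ˢ Set.Icc (min v.2 w.2) (max v.2 w.2)

/-- The cyclically next index. -/
def nextIdx {m : ℕ} (i : Fin m) : Fin m := ⟨((i : ℕ) + 1) % m, Nat.mod_lt _ i.pos⟩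

/-- The boundary curve of the polygon with cyclic vertex sequence `v`. -/
def polyBoundary {m : ℕ} (v : Fin m → ℝ × ℝ) : Set (ℝ × ℝ) :=
  ⋃ i, segment ℝ (v i) (v (nextIdx i))

/-- The closed region bounded by a curve `B`: the curve together with all points
whose connected component in the complement of `B` is bounded. -/
def boundedRegion (B : Set (ℝ × ℝ)) : Set (ℝ × ℝ) :=
  B ∪ {p | Bornology.IsBounded (connectedComponentIn Bᶜ p)}

/-- A simple rectilinear polygon with `2n` vertices, listed cyclically; the
even-indexed vertices are the initial vertices (`V₀`), the odd-indexed ones the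
terminal vertices (`V₁`).  Edges starting at even indices are horizontal, edges
starting at odd indices are vertical; horizontal edges have pairwise distinct
y-coordinates and vertical edges pairwise distinct x-coordinates; and the closed
curve is simple (non-adjacent edges are disjoint, adjacent edges meet only in
their common vertex). -/
def IsSimpleRectPolygon (n : ℕ) (v : Fin (2 * n) → ℝ × ℝ) : Prop :=
  0 < n ∧
  (∀ i : Fin (2 * n), (i : ℕ) % 2 = 0 →
    (v (nextIdx i)).2 = (v i).2 ∧ (v (nextIdx i)).1 ≠ (v i).1) ∧
  (∀ i : Fin (2 * n), (i : ℕ) % 2 = 1 →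
    (v (nextIdx i)).1 = (v i).1 ∧ (v (nextIdx i)).2 ≠ (v i).2) ∧
  (∀ i j : Fin (2 * n), (i : ℕ) % 2 = 1 → (j : ℕ) % 2 = 1 → (v i).1 = (v j).1 → i = j) ∧
  (∀ i j : Fin (2 * n), (i : ℕ) % 2 = 0 → (j : ℕ) % 2 = 0 → (v i).2 = (v j).2 → i = j) ∧
  Function.Injective v ∧
  (∀ i j : Fin (2 * n), i ≠ j → nextIdx i ≠ j → nextIdx j ≠ i →
    segment ℝ (v i) (v (nextIdx i)) ∩ segment ℝ (v j) (v (nextIdx j)) = ∅) ∧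
  (∀ i j : Fin (2 * n), nextIdx i = j → i ≠ j →
    segment ℝ (v i) (v (nextIdx i)) ∩ segment ℝ (v j) (v (nextIdx j)) = {v j})

namespace RPoly
open Set

set_option linter.unusedSectionVars false

noncomputable def lt01 (a b : ℝ) : ZMod 2 := if a < b then 1 else 0

variable {ι : Type} [Fintype ι]

/-- Boundary of the cyclic rectilinear polygon with coordinates `X`, `Y`. -/
def bdry (s : Equiv.Perm ι) (X Y : ι → ℝ) : Set (ℝ × ℝ) :=
  {p | ∃ i, (p.2 = Y i ∧ p.1 ∈ uIcc (X i) (X (s i))) ∨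
    (p.1 = X (s i) ∧ p.2 ∈ uIcc (Y i) (Y (s i)))}

noncomputable def up (s : Equiv.Perm ι) (X Y : ι → ℝ) (p : ℝ × ℝ) : ZMod 2 :=
  ∑ i, (lt01 p.1 (X i) + lt01 p.1 (X (s i))) * lt01 p.2 (Y i)

noncomputable def rt (s : Equiv.Perm ι) (X Y : ι → ℝ) (p : ℝ × ℝ) : ZMod 2 :=
  ∑ i, lt01 p.1 (X (s i)) * (lt01 p.2 (Y i) + lt01 p.2 (Y (s i)))

theorem zadd (a : ZMod 2) : a + a = 0 := by revert a; decide

theorem zcases (a : ZMod 2) : a = 0 ∨ a = 1 := by revert a; decide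

theorem up_eq_rt (s : Equiv.Perm ι) (X Y : ι → ℝ) (p : ℝ × ℝ) : up s X Y p = rt s X Y p := by
  have h : ∑ i, lt01 p.1 (X (s i)) * lt01 p.2 (Y (s i)) = ∑ i, lt01 p.1 (X i) * lt01 p.2 (Y i) :=
    Equiv.sum_comp s (fun i => lt01 p.1 (X i) * lt01 p.2 (Y i))
  simp only [up, rt, add_mul, mul_add, Finset.sum_add_distrib]
  rw [h, add_comm]

/-- `F` is constant along axis-parallel segments which avoid `D`. -/
def Inv {α : Type} (D : Set (ℝ × ℝ)) (F : ℝ × ℝ → α) : Prop :=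
  (∀ x y y', (∀ t ∈ uIcc y y', (x, t) ∉ D) → F (x, y) = F (x, y')) ∧
  (∀ y x x', (∀ t ∈ uIcc x x', (t, y) ∉ D) → F (x, y) = F (x', y))

theorem Inv.mono {α : Type} {D E : Set (ℝ × ℝ)} {F : ℝ × ℝ → α} (h : Inv D F) (hDE : D ⊆ E) :
    Inv E F :=
  ⟨fun x y y' ht => h.1 x y y' fun t h1 h2 => ht t h1 (hDE h2),
   fun x y y' ht => h.2 x y y' fun t h1 h2 => ht t h1 (hDE h2)⟩

theorem Inv.prod {α β : Type} {D : Set (ℝ × ℝ)} {F : ℝ × ℝ → α} {G : ℝ × ℝ → β}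
    (h : Inv D F) (h' : Inv D G) : Inv D (fun p => (F p, G p)) :=
  ⟨fun x y y' ht => by simp only [h.1 x y y' ht, h'.1 x y y' ht],
   fun x y y' ht => by simp only [h.2 x y y' ht, h'.2 x y y' ht]⟩

/-- The swapped function. -/
theorem Inv.swap {α : Type} {D : Set (ℝ × ℝ)} {F : ℝ × ℝ → α} (h : Inv D F) :
    Inv (Prod.swap ⁻¹' D) (fun p => F p.swap) :=
  ⟨fun x y y' ht => h.2 x y y' fun t h1 => ht t h1,
   fun x y y' ht => h.1 x y y' fun t h1 => ht t h1⟩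

/-- constancy on boxes -/
theorem Inv.box {α : Type} {D : Set (ℝ × ℝ)} {F : ℝ × ℝ → α} (h : Inv D F) {I J : Set ℝ}
    (hI : I.OrdConnected) (hJ : J.OrdConnected) (hD : ∀ x ∈ I, ∀ y ∈ J, (x, y) ∉ D)
    {p q : ℝ × ℝ} (hp : p.1 ∈ I ∧ p.2 ∈ J) (hq : q.1 ∈ I ∧ q.2 ∈ J) : F p = F q := by
  obtain ⟨p1, p2⟩ := p
  obtain ⟨q1, q2⟩ := q
  rw [h.1 p1 p2 q2 fun t ht => hD _ hp.1 _ (hJ.uIcc_subset hp.2 hq.2 ht)]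
  exact h.2 q2 p1 q1 fun t ht => hD _ (hI.uIcc_subset hp.1 hq.1 ht) _ hq.2

theorem lt01_ne_mem {a b c : ℝ} (h : lt01 a c ≠ lt01 b c) : c ∈ uIcc a b := by
  unfold lt01 at h
  rw [mem_uIcc]
  split_ifs at h with h1 h2 h2
  · exact absurd rfl h
  · left; constructor <;> linarith
  · right; constructor <;> linarith
  · exact absurd rfl h

theorem lt01_add_mem {a b c : ℝ} (h : lt01 c a + lt01 c b ≠ 0) : c ∈ uIcc a b := by
  unfold lt01 at h
  rw [mem_uIcc]
  split_ifs at h with h1 h2 h2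
  · exact absurd (zadd 1) h
  · right; constructor <;> linarith
  · left; constructor <;> linarith
  · exact absurd (zadd 0) h

theorem inv_up (s : Equiv.Perm ι) (X Y : ι → ℝ) : Inv (bdry s X Y) (up s X Y) := by
  constructor
  · intro x y y' h
    unfold up
    refine Finset.sum_congr rfl fun i _ => ?_
    dsimp only
    by_cases h0 : lt01 x (X i) + lt01 x (X (s i)) = 0
    · rw [h0]; simp
    by_cases h1 : lt01 y (Y i) = lt01 y' (Y i)
    · rw [h1]
    exact absurd ⟨i, Or.inl ⟨rfl, lt01_add_mem h0⟩⟩ (h _ (lt01_ne_mem h1))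
  · intro y x x' h
    rw [up_eq_rt, up_eq_rt]
    unfold rt
    refine Finset.sum_congr rfl fun i _ => ?_
    dsimp only
    by_cases h0 : lt01 y (Y i) + lt01 y (Y (s i)) = 0
    · rw [h0]; simp
    by_cases h1 : lt01 x (X (s i)) = lt01 x' (X (s i))
    · rw [h1]
    exact absurd ⟨i, Or.inr ⟨rfl, lt01_add_mem h0⟩⟩ (h _ (lt01_ne_mem h1))

theorem up_swap (s : Equiv.Perm ι) (X Y : ι → ℝ) (p : ℝ × ℝ) :
    up s Y (X ∘ s) p.swap = up s X Y p := by
  rw [up_eq_rt s X Y]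
  simp only [up, rt, Prod.fst_swap, Prod.snd_swap, Function.comp]
  exact Finset.sum_congr rfl fun i _ => mul_comm _ _

theorem bdry_swap (s : Equiv.Perm ι) (X Y : ι → ℝ) (p : ℝ × ℝ) :
    p.swap ∈ bdry s Y (X ∘ s) ↔ p ∈ bdry s X Y := by
  simp only [bdry, mem_ofPred_eq, Prod.fst_swap, Prod.snd_swap, Function.comp]
  constructor
  · rintro ⟨i, h | h⟩
    · exact ⟨i, Or.inr h⟩
    · exact ⟨s i, Or.inl h⟩
  · rintro ⟨i, h | h⟩
    · exact ⟨s.symm i, Or.inr (by simpa using h)⟩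
    · exact ⟨i, Or.inl h⟩

theorem isClosed_bdry (s : Equiv.Perm ι) (X Y : ι → ℝ) : IsClosed (bdry s X Y) := by
  have : bdry s X Y = ⋃ i, ((uIcc (X i) (X (s i)) ×ˢ {Y i}) ∪ ({X (s i)} ×ˢ uIcc (Y i) (Y (s i)))) := by
    ext p
    simp only [bdry, mem_ofPred_eq, mem_iUnion, mem_union, mem_prod, mem_singleton_iff]
    refine exists_congr fun i => ?_
    tauto
  rw [this]
  refine isClosed_iUnion_of_finite fun i => ?_
  exact (isClosed_Icc.prod isClosed_singleton).union (isClosed_singleton.prod isClosed_Icc)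

/-- local constancy -/
theorem local_const (s : Equiv.Perm ι) (X Y : ι → ℝ) {p : ℝ × ℝ} (hp : p ∉ bdry s X Y) :
    ∃ δ > 0, ∀ x y, |x - p.1| < δ → |y - p.2| < δ →
      (x, y) ∉ bdry s X Y ∧ up s X Y (x, y) = up s X Y p := by
  have ho : IsOpen (bdry s X Y)ᶜ := (isClosed_bdry s X Y).isOpen_compl
  obtain ⟨δ, hδ, hb⟩ := Metric.isOpen_iff.1 ho p hp
  have hB : ∀ x ∈ Ioo (p.1 - δ) (p.1 + δ), ∀ y ∈ Ioo (p.2 - δ) (p.2 + δ), (x, y) ∉ bdry s X Y := by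
    intro x hx y hy
    apply hb
    rw [Metric.mem_ball, Prod.dist_eq, max_lt_iff, Real.dist_eq, Real.dist_eq, abs_lt, abs_lt]
    simp only [mem_Ioo] at hx hy
    refine ⟨⟨?_, ?_⟩, ?_, ?_⟩ <;> dsimp only <;> linarith
  refine ⟨δ, hδ, fun x y hx hy => ?_⟩
  rw [abs_lt] at hx hy
  have hx' : x ∈ Ioo (p.1 - δ) (p.1 + δ) := ⟨by linarith, by linarith⟩
  have hy' : y ∈ Ioo (p.2 - δ) (p.2 + δ) := ⟨by linarith, by linarith⟩
  exact ⟨hB x hx' y hy', (inv_up s X Y).box ordConnected_Ioo ordConnected_Ioo hB ⟨hx', hy'⟩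
    ⟨⟨by linarith, by linarith⟩, ⟨by linarith, by linarith⟩⟩⟩

theorem isOpen_val (s : Equiv.Perm ι) (X Y : ι → ℝ) (c : ZMod 2) :
    IsOpen {p | p ∉ bdry s X Y ∧ up s X Y p = c} := by
  rw [Metric.isOpen_iff]
  rintro p ⟨hp, hc⟩
  obtain ⟨δ, hδ, h⟩ := local_const s X Y hp
  refine ⟨δ, hδ, ?_⟩
  rintro ⟨x, y⟩ hq
  rw [Metric.mem_ball, Prod.dist_eq, max_lt_iff, Real.dist_eq, Real.dist_eq] at hq
  have := h x y hq.1 hq.2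
  exact ⟨this.1, this.2.trans hc⟩

/-- odd points are in a box -/
theorem up_box (s : Equiv.Perm ι) (X Y : ι → ℝ) {p : ℝ × ℝ} (h : up s X Y p ≠ 0) :
    (∃ i, p.1 < X i) ∧ (∃ i, X i ≤ p.1) ∧ (∃ i, p.2 < Y i) ∧ (∃ i, Y i ≤ p.2) := by
  refine ⟨?_, ?_, ?_, ?_⟩ <;> by_contra! hc <;> apply h
  · exact Finset.sum_eq_zero fun i _ => by simp [lt01, not_lt.2 (hc _)]
  · exact Finset.sum_eq_zero fun i _ => by simp [lt01, hc, zadd]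
  · exact Finset.sum_eq_zero fun i _ => by simp [lt01, not_lt.2 (hc _)]
  · rw [up_eq_rt]; exact Finset.sum_eq_zero fun i _ => by simp [lt01, hc, zadd]

end RPoly
namespace RPoly
open Set
set_option linter.unusedSectionVars false
variable {ι : Type} [Fintype ι]

structure RP (s : Equiv.Perm ι) (X Y : ι → ℝ) (ε : ℝ) : Prop where
  eps : 0 < ε
  gapX : ∀ i j, i ≠ j → 4 * ε < |X i - X j|
  gapY : ∀ i j, i ≠ j → 4 * ε < |Y i - Y j|
  ne : ∀ i, s i ≠ i
  cross : ∀ i j, X (s j) ∈ uIcc (X i) (X (s i)) → Y i ∈ uIcc (Y j) (Y (s j)) → j = i ∨ s j = i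

variable {s : Equiv.Perm ι} {X Y : ι → ℝ} {ε : ℝ}

theorem RP.swap (h : RP s X Y ε) : RP s Y (X ∘ s) ε where
  eps := h.eps
  gapX := h.gapY
  gapY := fun i j hij => h.gapX _ _ fun hc => hij (s.injective hc)
  ne := h.ne
  cross := fun i j h1 h2 => by
    rcases h.cross (s j) i h2 h1 with h3 | h3
    · exact Or.inr h3.symm
    · exact Or.inl (s.injective h3.symm)

theorem RP.gx (h : RP s X Y ε) (i j : ι) : i = j ∨ X i + 4 * ε < X j ∨ X j + 4 * ε < X i := by
  by_cases hij : i = j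
  · exact Or.inl hij
  right
  have := h.gapX i j hij
  rcases abs_cases (X i - X j) with h1 | h1
  · right; linarith
  · left; linarith

theorem RP.gy (h : RP s X Y ε) (i j : ι) : i = j ∨ Y i + 4 * ε < Y j ∨ Y j + 4 * ε < Y i := by
  by_cases hij : i = j
  · exact Or.inl hij
  right
  have := h.gapY i j hij
  rcases abs_cases (Y i - Y j) with h1 | h1
  · right; linarith
  · left; linarith

theorem RP.injX (h : RP s X Y ε) {i j : ι} (hij : X i = X j) : i = j := by
  have := h.eps
  rcases h.gx i j with h | h | h
  · exact h
  · linarith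
  · linarith

theorem RP.injY (h : RP s X Y ε) {i j : ι} (hij : Y i = Y j) : i = j := by
  have := h.eps
  rcases h.gy i j with h | h | h
  · exact h
  · linarith
  · linarith

/-- Obstacle set agreeing with the boundary near vertical edges. -/
def Good (s : Equiv.Perm ι) (X Y : ι → ℝ) (ε : ℝ) (D : Set (ℝ × ℝ)) : Prop :=
  ∀ p ∈ D, p ∉ bdry s X Y → ∀ k, ε < |p.1 - X k|

theorem good_self (s : Equiv.Perm ι) (X Y : ι → ℝ) (ε : ℝ) : Good s X Y ε (bdry s X Y) :=
  fun _ h1 h2 => absurd h1 h2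

def Sg (ε σ : ℝ) : Prop := σ = ε ∨ σ = -ε

theorem Sg.neg {ε σ : ℝ} (h : Sg ε σ) : Sg ε (-σ) := by
  rcases h with rfl | rfl
  · exact Or.inr rfl
  · exact Or.inl (neg_neg _)

/-- inner strip of a vertical edge -/
def Inner (Y : ι → ℝ) (ε : ℝ) (i j : ι) (y : ℝ) : Prop :=
  (Y i + ε ≤ y ∧ y ≤ Y j - ε) ∨ (Y j + ε ≤ y ∧ y ≤ Y i - ε)

theorem RP.strip (h : RP s X Y ε) {D : Set (ℝ × ℝ)} (hD : Good s X Y ε D) {e : ι} {σ y : ℝ}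
    (hσ : Sg ε σ) (hy : Inner Y ε e (s e) y) : (X (s e) + σ, y) ∉ D := by
  intro hp
  have he := h.eps
  have hB : (X (s e) + σ, y) ∈ bdry s X Y := by
    by_contra hc
    have := hD _ hp hc (s e)
    have h2 : |X (s e) + σ - X (s e)| = ε := by
      rcases hσ with rfl | rfl
      · rw [add_sub_cancel_left, abs_of_pos he]
      · rw [add_sub_cancel_left, abs_neg, abs_of_pos he]
    dsimp only at this
    linarith
  obtain ⟨i, ⟨h1, h2⟩ | ⟨h1, h2⟩⟩ := hB
  · dsimp only at h1 h2
    have hx : X (s e) ∈ uIcc (X i) (X (s i)) := by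
      rw [mem_uIcc] at h2 ⊢
      rcases h.gx (s e) i with h3 | h3 | h3 <;> rcases h.gx (s e) (s i) with h4 | h4 | h4 <;>
      rcases hσ with rfl | rfl <;> (try rw [← h3] at h2 ⊢) <;> (try rw [← h4] at h2 ⊢) <;>
      (rcases h2 with h2 | h2
       · (try (left; constructor <;> linarith)) <;> (exfalso; linarith)
       · (try (right; constructor <;> linarith)) <;> (exfalso; linarith))
    have hy' : Y i ∈ uIcc (Y e) (Y (s e)) := by
      rw [mem_uIcc, ← h1]
      rcases hy with hy | hy
      · left; constructor <;> linarith
      · right; constructor <;> linarith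
    rcases h.cross i e hx hy' with h5 | h5
    · rw [← h5] at h1
      rcases hy with hy | hy <;> linarith
    · rw [← h5] at h1
      rcases hy with hy | hy <;> linarith
  · dsimp only at h1
    rcases h.gx (s e) (s i) with h3 | h3 | h3
    · rw [← h3] at h1
      rcases hσ with rfl | rfl <;> linarith
    · rcases hσ with rfl | rfl <;> linarith
    · rcases hσ with rfl | rfl <;> linarith

theorem inner_ord (i j : ι) : (Set.ofPred (Inner Y ε i j)).OrdConnected ∨ ε ≤ 0 := by
  by_cases he : ε ≤ 0
  · exact Or.inr he
  left
  refine ⟨fun a ha b hb c hc => ?_⟩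
  rcases ha with ha | ha <;> rcases hb with hb | hb
  · left; constructor <;> linarith [hc.1, hc.2]
  · exfalso; linarith
  · exfalso; linarith
  · right; constructor <;> linarith [hc.1, hc.2]

theorem RP.side (h : RP s X Y ε) {α : Type} {D : Set (ℝ × ℝ)} (hD : Good s X Y ε D)
    {F : ℝ × ℝ → α} (hF : Inv D F) {e : ι} {σ y y' : ℝ} (hσ : Sg ε σ)
    (hy : Inner Y ε e (s e) y) (hy' : Inner Y ε e (s e) y') :
    F (X (s e) + σ, y) = F (X (s e) + σ, y') := by
  refine hF.1 _ _ _ fun t ht => h.strip hD hσ ?_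
  rcases inner_ord (Y := Y) (ε := ε) e (s e) with h1 | h1
  · exact h1.uIcc_subset hy hy' ht
  · exact absurd h.eps (not_lt.2 h1)

/-- vertex of vertical edge `e`: at `(X (s e), Y c)`, other ends `Y f` and `X g` -/
def Vtx (s : Equiv.Perm ι) (e c f g : ι) : Prop :=
  (c = e ∧ f = s e ∧ g = e) ∨ (c = s e ∧ f = e ∧ g = s (s e))

theorem Vtx.swap {e c f g : ι} (h : Vtx s e c f g) : Vtx s (s.symm c) e (s.symm g) f := by
  rcases h with ⟨rfl, rfl, rfl⟩ | ⟨rfl, rfl, rfl⟩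
  · right; simp
  · left; simp

theorem RP.nearv (h : RP s X Y ε) {D : Set (ℝ × ℝ)} (hD : Good s X Y ε D) {e c f g : ι}
    (hv : Vtx s e c f g) {a b : ℝ} (ha : |a| ≤ ε) (hb : |b| ≤ ε) (hp : (X (s e) + a, Y c + b) ∈ D) :
    (b = 0 ∧ (0 ≤ a ↔ X (s e) < X g ∨ a = 0)) ∨ (a = 0 ∧ (0 ≤ b ↔ Y c < Y f ∨ b = 0)) := by
  have he := h.eps
  have hB : (X (s e) + a, Y c + b) ∈ bdry s X Y := by
    by_contra hc
    have := hD _ hp hc (s e)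
    dsimp only at this
    rw [add_sub_cancel_left] at this
    linarith
  rw [abs_le] at ha hb
  obtain ⟨i, ⟨h1, h2⟩ | ⟨h1, h2⟩⟩ := hB
  · left
    dsimp only at h1 h2
    have hci : c = i := by
      rcases h.gy c i with h3 | h3 | h3
      · exact h3
      · linarith
      · linarith
    subst hci
    refine ⟨by linarith, ?_⟩
    have h2' : X (s e) + a ∈ uIcc (X (s e)) (X g) := by
      rcases hv with ⟨rfl, rfl, rfl⟩ | ⟨rfl, rfl, rfl⟩
      · rwa [uIcc_comm]
      · exact h2
    rw [mem_uIcc] at h2'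
    constructor
    · intro h4
      rcases h4.eq_or_lt with h4 | h4
      · exact Or.inr h4.symm
      · left; rcases h2' with h5 | h5 <;> linarith
    · rintro (h4 | h4)
      · rcases h2' with h5 | h5 <;> linarith
      · linarith
  · right
    dsimp only at h1 h2
    have hci : s e = s i := by
      rcases h.gx (s e) (s i) with h3 | h3 | h3
      · exact h3
      · linarith
      · linarith
    have hei := s.injective hci
    subst hei
    refine ⟨by linarith, ?_⟩
    have h2' : Y c + b ∈ uIcc (Y c) (Y f) := by
      rcases hv with ⟨rfl, rfl, rfl⟩ | ⟨rfl, rfl, rfl⟩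
      · exact h2
      · rwa [uIcc_comm]
    rw [mem_uIcc] at h2'
    constructor
    · intro h4
      rcases h4.eq_or_lt with h4 | h4
      · exact Or.inr h4.symm
      · left; rcases h2' with h5 | h5 <;> linarith
    · rintro (h4 | h4)
      · rcases h2' with h5 | h5 <;> linarith
      · linarith

theorem Sg.abs {ε σ : ℝ} (he : 0 < ε) (h : Sg ε σ) : |σ| = ε := by
  rcases h with rfl | rfl
  · exact abs_of_pos he
  · rw [abs_neg, abs_of_pos he]

theorem Vtx.inner (h : RP s X Y ε) {e c f g : ι} (hv : Vtx s e c f g) {b : ℝ} (hb : Sg ε b)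
    (hd : 0 < b ↔ Y c < Y f) : Inner Y ε e (s e) (Y c + b) := by
  have he := h.eps
  have hcf : c ≠ f := by
    rcases hv with ⟨rfl, rfl, rfl⟩ | ⟨rfl, rfl, rfl⟩
    · exact (h.ne _).symm
    · exact h.ne _
  have key : Inner Y ε c f (Y c + b) := by
    rcases h.gy c f with h3 | h3 | h3
    · exact absurd h3 hcf
    · have : 0 < b := hd.2 (by linarith)
      left; rcases hb with rfl | rfl <;> constructor <;> linarith
    · have : ¬ 0 < b := fun hc => by have := hd.1 hc; linarith
      right; rcases hb with rfl | rfl <;> constructor <;> linarith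
  rcases hv with ⟨rfl, rfl, rfl⟩ | ⟨rfl, rfl, rfl⟩
  · exact key
  · exact key.symm

theorem RP.quad (h : RP s X Y ε) {α : Type} {D : Set (ℝ × ℝ)} (hD : Good s X Y ε D)
    {F : ℝ × ℝ → α} (hF : Inv D F) {e c f g : ι} (hv : Vtx s e c f g) {a b y : ℝ}
    (ha : Sg ε a) (hb : Sg ε b) (hy : Inner Y ε e (s e) y) :
    ∃ σ, Sg ε σ ∧ F (X (s e) + a, Y c + b) = F (X (s e) + σ, y) := by
  have he := h.eps
  have ha' := ha.abs he
  have hb' := hb.abs he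
  have ha0 : a ≠ 0 := fun h0 => by rw [h0, abs_zero] at ha'; linarith
  have hb0 : b ≠ 0 := fun h0 => by rw [h0, abs_zero] at hb'; linarith
  by_cases hd : 0 < b ↔ Y c < Y f
  · exact ⟨a, ha, h.side hD hF ha (hv.inner h hb hd) hy⟩
  have hd' : 0 < -b ↔ Y c < Y f := by
    rcases lt_or_gt_of_ne hb0 with h1 | h1
    · have : ¬ 0 < b := not_lt.2 h1.le
      have h2 : 0 < -b := by linarith
      tauto
    · have : ¬ 0 < -b := by linarith
      tauto
  have vert : ∀ a', Sg ε a' → ¬ (0 ≤ a' ↔ X (s e) < X g) →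
      F (X (s e) + a', Y c + b) = F (X (s e) + a', y) := by
    intro a' hs hn
    have ha2 := hs.abs he
    have ha3 : a' ≠ 0 := fun h0 => by rw [h0, abs_zero] at ha2; linarith
    rw [← h.side hD hF hs (hv.inner h hb.neg hd') hy]
    refine hF.1 _ _ _ fun t ht hc => ?_
    have ht' : |t - Y c| ≤ ε := by
      rw [mem_uIcc] at ht
      rw [abs_le]
      rcases hb with rfl | rfl <;> rcases ht with ht | ht <;> constructor <;> linarith
    rw [show t = Y c + (t - Y c) by ring] at hc
    rcases h.nearv hD hv ha2.le ht' hc with ⟨_, h5⟩ | ⟨h4, h5⟩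
    · simp only [ha3, or_false] at h5
      exact hn h5
    · exact ha3 h4
  by_cases hg : 0 ≤ a ↔ X (s e) < X g
  · have hg' : ¬ (0 ≤ -a ↔ X (s e) < X g) := by
      rcases lt_or_gt_of_ne ha0 with h1 | h1
      · have : ¬ 0 ≤ a := not_le.2 h1
        have h2 : 0 ≤ -a := by linarith
        tauto
      · have : ¬ 0 ≤ -a := by linarith
        have h2 : 0 ≤ a := h1.le
        tauto
    refine ⟨-a, ha.neg, ?_⟩
    rw [← vert _ ha.neg hg']
    refine hF.2 _ _ _ fun t ht hc => ?_
    have ht' : |t - X (s e)| ≤ ε := by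
      rw [mem_uIcc] at ht
      rw [abs_le]
      rcases ha with rfl | rfl <;> rcases ht with ht | ht <;> constructor <;> linarith
    rw [show t = X (s e) + (t - X (s e)) by ring] at hc
    rcases h.nearv hD hv ht' hb'.le hc with ⟨h4, h5⟩ | ⟨_, h5⟩
    · exact hb0 h4
    · simp only [hb0, or_false] at h5
      apply hd
      rw [← h5]
      exact ⟨le_of_lt, fun h6 => lt_of_le_of_ne h6 hb0.symm⟩
  · exact ⟨a, ha, vert a ha hg⟩

/-- jump of the parity across a vertical edge -/
theorem jump (s : Equiv.Perm ι) (X Y : ι → ℝ) (e : ι) {x x' y : ℝ} (h1 : x < X (s e))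
    (h2 : X (s e) ≤ x') (h3 : ∀ k, k ≠ e → (x < X (s k) ↔ x' < X (s k)))
    (h4 : lt01 y (Y e) + lt01 y (Y (s e)) = 1) :
    up s X Y (x, y) + up s X Y (x', y) = 1 := by
  classical
  rw [up_eq_rt, up_eq_rt]
  unfold rt
  rw [← Finset.add_sum_erase _ _ (Finset.mem_univ e), ← Finset.add_sum_erase (a := e) _ _ (Finset.mem_univ e)]
  have : ∑ k ∈ Finset.univ.erase e, lt01 x (X (s k)) * (lt01 y (Y k) + lt01 y (Y (s k))) =
      ∑ k ∈ Finset.univ.erase e, lt01 x' (X (s k)) * (lt01 y (Y k) + lt01 y (Y (s k))) := by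
    refine Finset.sum_congr rfl fun k hk => ?_
    have := h3 k (Finset.ne_of_mem_erase hk)
    simp only [lt01, this]
  dsimp only
  rw [this, h4]
  simp only [lt01, h1, not_lt.2 h2, if_true, if_false]
  rw [add_add_add_comm, zadd]
  norm_num

theorem lt01_between {a b y : ℝ} (h : (a ≤ y ∧ y < b) ∨ (b ≤ y ∧ y < a)) :
    lt01 y a + lt01 y b = 1 := by
  rcases h with h | h
  · simp [lt01, not_lt.2 h.1, h.2]
  · simp [lt01, not_lt.2 h.1, h.2]

theorem RP.jump (h : RP s X Y ε) (e : ι) {y δ : ℝ} (hy : (Y e < y ∧ y < Y (s e)) ∨ (Y (s e) < y ∧ y < Y e))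
    (h0 : 0 < δ) (h1 : δ ≤ ε) :
    up s X Y (X (s e) + -δ, y) + up s X Y (X (s e) + δ, y) = 1 := by
  apply RPoly.jump s X Y e
  · linarith
  · linarith
  · intro k hk
    rcases h.gx (s e) (s k) with h3 | h3 | h3
    · exact absurd (s.injective h3.symm) hk
    · constructor <;> intro <;> linarith
    · constructor <;> intro <;> linarith
  · apply lt01_between
    rcases hy with hy | hy
    · left; exact ⟨hy.1.le, hy.2⟩
    · right; exact ⟨hy.1.le, hy.2⟩

end RPoly
namespace RPoly
open Set
set_option linter.unusedSectionVars false
variable {ι : Type} [Fintype ι]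
variable {s : Equiv.Perm ι} {X Y : ι → ℝ} {ε : ℝ}

noncomputable def mid (a b : ℝ) : ℝ := (a + b) / 2

theorem inv_swap {α : Type} {F : ℝ × ℝ → α} (hF : Inv (bdry s X Y) F) :
    Inv (bdry s Y (X ∘ s)) (fun p => F p.swap) := by
  refine hF.swap.mono fun p hp => ?_
  have := (bdry_swap s X Y p.swap).2 hp
  simpa using this

theorem RP.mid_inner (h : RP s X Y ε) (e : ι) : Inner Y ε e (s e) (mid (Y e) (Y (s e))) := by
  have he := h.eps
  unfold mid
  rcases h.gy e (s e) with h3 | h3 | h3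
  · exact absurd h3.symm (h.ne e)
  · left; constructor <;> linarith
  · right; constructor <;> linarith

theorem RP.toH (h : RP s X Y ε) {α : Type} {F : ℝ × ℝ → α} (hF : Inv (bdry s X Y) F)
    (e : ι) {σ : ℝ} (hσ : Sg ε σ) :
    ∃ τ, Sg ε τ ∧ F (X (s e) + σ, mid (Y e) (Y (s e))) =
      F (mid (X (s e)) (X (s (s e))), Y (s e) + τ) := by
  have he := h.eps
  have hv : Vtx s e (s e) e (s (s e)) := Or.inr ⟨rfl, rfl, rfl⟩
  obtain ⟨b, hb, hd⟩ : ∃ b, Sg ε b ∧ (0 < b ↔ Y (s e) < Y e) := by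
    by_cases hc : Y (s e) < Y e
    · exact ⟨ε, Or.inl rfl, by simp [hc, he]⟩
    · exact ⟨-ε, Or.inr rfl, by simp [hc, he.le]⟩
  rw [h.side (good_self _ _ _ _) hF hσ (h.mid_inner e) (hv.inner h hb hd)]
  have hv' : Vtx s e e (s e) e := Or.inl ⟨rfl, rfl, rfl⟩
  obtain ⟨τ, hτ, hh⟩ := h.swap.quad (good_self _ _ _ _) (inv_swap hF) hv' hb hσ (h.swap.mid_inner e)
  exact ⟨τ, hτ, hh⟩

theorem RP.toR (h : RP s X Y ε) {α : Type} {F : ℝ × ℝ → α} (hF : Inv (bdry s X Y) F)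
    (e : ι) {τ : ℝ} (hτ : Sg ε τ) :
    ∃ σ, Sg ε σ ∧ F (mid (X (s e)) (X (s (s e))), Y (s e) + τ) =
      F (X (s (s e)) + σ, mid (Y (s e)) (Y (s (s e)))) :=
  h.swap.toH (inv_swap hF) e hτ

def Cyc (s : Equiv.Perm ι) : Prop := ∀ P : ι → Prop, (∃ i, P i) → (∀ i, P i → P (s i)) → ∀ i, P i

theorem RP.allR (h : RP s X Y ε) (hc : Cyc s) {α : Type} {F : ℝ × ℝ → α}
    (hF : Inv (bdry s X Y) F) (e₀ e : ι) {σ : ℝ} (hσ : Sg ε σ) :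
    ∃ σ', Sg ε σ' ∧ F (X (s e) + σ, mid (Y e) (Y (s e))) =
      F (X (s e₀) + σ', mid (Y e₀) (Y (s e₀))) := by
  by_contra hn
  have := hc (fun e => ¬ ∀ σ, Sg ε σ → ∃ σ', Sg ε σ' ∧ F (X (s e) + σ, mid (Y e) (Y (s e))) =
      F (X (s e₀) + σ', mid (Y e₀) (Y (s e₀)))) ⟨e, fun h => hn (h _ hσ)⟩ (by
    intro i hi hi'
    apply hi
    intro σ hσ
    obtain ⟨τ, hτ, h1⟩ := h.toH hF i hσ
    obtain ⟨σ', hσ', h2⟩ := h.toR hF i hτ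
    obtain ⟨σ'', hσ'', h3⟩ := hi' σ' hσ'
    exact ⟨σ'', hσ'', h1.trans (h2.trans h3)⟩) e₀
  exact this fun σ hσ => ⟨σ, hσ, rfl⟩

theorem exists_generic (X : ι → ℝ) {a b : ℝ} (hab : a < b) : ∃ x ∈ Ioo a b, ∀ i, x ≠ X i := by
  have : (Ioo a b \ range X).Nonempty :=
    ((Ioo_infinite hab).sdiff (finite_range X)).nonempty
  obtain ⟨x, hx, hx'⟩ := this
  exact ⟨x, hx, fun i hi => hx' ⟨i, hi.symm⟩⟩

theorem RP.escape (h : RP s X Y ε) {α : Type} {F : ℝ × ℝ → α}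
    (hF : Inv (bdry s X Y) F) {p : ℝ × ℝ} (hp : p ∉ bdry s X Y) :
    (∃ q : ℝ × ℝ, F p = F q ∧ ∀ t, q.2 ≤ t → (q.1, t) ∉ bdry s X Y) ∨
    ∃ e τ, Sg ε τ ∧ F p = F (mid (X (s e)) (X (s (s e))), Y (s e) + τ) := by
  classical
  have he := h.eps
  obtain ⟨δ, hδ, hl⟩ := local_const s X Y hp
  obtain ⟨x, hx, hg⟩ := exists_generic X (show p.1 < p.1 + δ by linarith)
  have hq : (x, p.2) ∉ bdry s X Y :=
    (hl x p.2 (by rw [abs_lt]; constructor <;> linarith [hx.1, hx.2]) (by simpa using hδ)).1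
  have hFq : F p = F (x, p.2) := by
    refine hF.2 p.2 p.1 x fun t ht => (hl t p.2 ?_ (by simpa using hδ)).1
    rw [uIcc_of_le hx.1.le] at ht
    rw [abs_lt]; constructor <;> linarith [hx.1, hx.2, ht.1, ht.2]
  by_cases hS : ∃ i, x ∈ uIcc (X i) (X (s i)) ∧ p.2 < Y i
  swap
  · left
    refine ⟨(x, p.2), hFq, ?_⟩
    rintro t ht ⟨i, ⟨h1, h2⟩ | ⟨h1, h2⟩⟩
    · dsimp only at h1 h2 ht
      rcases ht.eq_or_lt with h3 | h3
      · exact hq ⟨i, Or.inl ⟨h3.trans h1, h2⟩⟩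
      · exact hS ⟨i, h2, by linarith⟩
    · exact hg _ h1
  · right
    obtain ⟨i0, hi0⟩ := hS
    obtain ⟨c, hc, hmin⟩ := Finset.exists_min_image
      (Finset.univ.filter fun i => x ∈ uIcc (X i) (X (s i)) ∧ p.2 < Y i) Y ⟨i0, by simpa using hi0⟩
    simp only [Finset.mem_filter, Finset.mem_univ, true_and] at hc hmin
    have h1 : F (x, p.2) = F (x, Y c + -ε) := by
      refine hF.1 _ _ _ fun t ht => ?_
      rintro ⟨i, ⟨h1, h2⟩ | ⟨h1, h2⟩⟩
      · dsimp only at h1 h2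
        rw [mem_uIcc] at ht
        rcases lt_trichotomy p.2 (Y i) with h3 | h3 | h3
        · have := hmin i ⟨h2, h3⟩
          rcases ht with ht | ht <;> linarith
        · exact hq ⟨i, Or.inl ⟨h3, h2⟩⟩
        · rcases ht with ht | ht
          · linarith
          · rcases h.gy i c with h4 | h4 | h4
            · rw [h4] at h3; linarith
            · linarith
            · linarith
      · exact hg _ h1
    have hxi : (X c < x ∧ x < X (s c)) ∨ (X (s c) < x ∧ x < X c) := by
      rcases mem_uIcc.1 hc.1 with h2 | h2
      · left; exact ⟨lt_of_le_of_ne h2.1 (hg _).symm, lt_of_le_of_ne h2.2 (hg _)⟩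
      · right; exact ⟨lt_of_le_of_ne h2.1 (hg _).symm, lt_of_le_of_ne h2.2 (hg _)⟩
    have h2 : F (x, Y c + -ε) = F (mid (X c) (X (s c)), Y c + -ε) := by
      refine hF.2 _ _ _ fun t ht => ?_
      have hti : (X c < t ∧ t < X (s c)) ∨ (X (s c) < t ∧ t < X c) := by
        unfold mid at ht
        rw [mem_uIcc] at ht
        rcases hxi with h3 | h3
        · left; rcases ht with ht | ht <;> constructor <;> linarith
        · right; rcases ht with ht | ht <;> constructor <;> linarith
      rintro ⟨i, ⟨h1, h2⟩ | ⟨h1, h2⟩⟩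
      · dsimp only at h1
        rcases h.gy i c with h4 | h4 | h4
        · rw [h4] at h1; linarith
        · linarith
        · linarith
      · dsimp only at h1 h2
        have hX : X (s i) ∈ uIcc (X c) (X (s c)) := by
          rw [mem_uIcc, ← h1]
          rcases hti with h3 | h3
          · left; exact ⟨h3.1.le, h3.2.le⟩
          · right; exact ⟨h3.1.le, h3.2.le⟩
        have hY : Y c ∈ uIcc (Y i) (Y (s i)) := by
          rw [mem_uIcc] at h2 ⊢
          rcases h2 with h2 | h2
          · left
            refine ⟨by linarith, ?_⟩
            rcases h.gy (s i) c with h4 | h4 | h4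
            · rw [h4]
            · linarith
            · linarith
          · right
            refine ⟨by linarith, ?_⟩
            rcases h.gy i c with h4 | h4 | h4
            · rw [h4]
            · linarith
            · linarith
        rcases h.cross c i hX hY with h4 | h4
        · rw [h4] at h1; rcases hti with h3 | h3 <;> linarith
        · rw [h4] at h1; rcases hti with h3 | h3 <;> linarith
    refine ⟨s.symm c, -ε, Or.inr rfl, ?_⟩
    rw [Equiv.apply_symm_apply]
    exact hFq.trans (h1.trans h2)

theorem inv_cc (B : Set (ℝ × ℝ)) : Inv B (fun p => connectedComponentIn Bᶜ p) := by
  constructor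
  · intro x y y' ht
    apply connectedComponentIn_eq
    have : IsPreconnected (({x} : Set ℝ) ×ˢ uIcc y y') :=
      isPreconnected_singleton.prod isPreconnected_uIcc
    refine this.subset_connectedComponentIn (mk_mem_prod (mem_singleton x) left_mem_uIcc) ?_
      (mk_mem_prod (mem_singleton x) right_mem_uIcc)
    rintro ⟨a, b⟩ ⟨ha, hb⟩
    rw [mem_singleton_iff] at ha
    dsimp only at ha hb
    subst ha
    exact ht _ hb
  · intro y x x' ht
    apply connectedComponentIn_eq
    have : IsPreconnected (uIcc x x' ×ˢ ({y} : Set ℝ)) :=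
      isPreconnected_uIcc.prod isPreconnected_singleton
    refine this.subset_connectedComponentIn (mk_mem_prod left_mem_uIcc (mem_singleton y)) ?_
      (mk_mem_prod right_mem_uIcc (mem_singleton y))
    rintro ⟨a, b⟩ ⟨ha, hb⟩
    rw [mem_singleton_iff] at hb
    dsimp only at ha hb
    subst hb
    exact ht _ ha

theorem ray_unbounded {B : Set (ℝ × ℝ)} {q : ℝ × ℝ} (hq : ∀ t, q.2 ≤ t → (q.1, t) ∉ B) :
    ¬ Bornology.IsBounded (connectedComponentIn Bᶜ q) := by
  intro hb
  have hsub : ({q.1} : Set ℝ) ×ˢ Ici q.2 ⊆ connectedComponentIn Bᶜ q := by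
    have : IsPreconnected (({q.1} : Set ℝ) ×ˢ Ici q.2) :=
      isPreconnected_singleton.prod isPreconnected_Ici
    refine this.subset_connectedComponentIn (mk_mem_prod (mem_singleton _) self_mem_Ici) ?_
    rintro ⟨a, b⟩ ⟨ha, hb⟩
    rw [mem_singleton_iff] at ha
    dsimp only at ha hb
    subst ha
    exact hq _ hb
  obtain ⟨M, hM⟩ := (hb.subset hsub).exists_norm_le
  have := hM (q.1, max q.2 (M + 1)) (mk_mem_prod (mem_singleton _) (mem_Ici.2 (le_max_left _ _)))
  have h2 : ‖max q.2 (M + 1)‖ ≤ M := (norm_snd_le (q.1, max q.2 (M + 1))).trans this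
  have h3 := le_abs_self (max q.2 (M + 1))
  rw [Real.norm_eq_abs] at h2
  linarith [le_max_right q.2 (M + 1)]

theorem RP.region (h : RP s X Y ε) (hc : Cyc s) [Nonempty ι] :
    boundedRegion (bdry s X Y) = {p | p ∈ bdry s X Y ∨ up s X Y p = 1} := by
  have he := h.eps
  ext p
  simp only [boundedRegion, mem_union, mem_ofPred_eq]
  by_cases hp : p ∈ bdry s X Y
  · simp [hp]
  simp only [hp, false_or]
  constructor
  · intro hb
    by_contra h1
    have h0 : up s X Y p = 0 := (zcases _).resolve_right h1
    have hF := (inv_cc (bdry s X Y)).prod (inv_up s X Y)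
    rcases h.escape hF hp with ⟨q, hq, hr⟩ | ⟨e, τ, hτ, hq⟩
    · simp only [Prod.mk.injEq] at hq
      rw [hq.1] at hb
      exact ray_unbounded hr hb
    -- the topmost edge
    obtain ⟨e₀, htop⟩ := Finite.exists_max (fun i => Y (s i))
    have htop' : ∀ i, Y i ≤ Y (s e₀) := fun i => by simpa using htop (s.symm i)
    obtain ⟨σ, hσ, h3⟩ := h.toR hF e hτ
    obtain ⟨σ₁, hσ₁, h4⟩ := h.allR hc hF e₀ (s e) hσ
    obtain ⟨σ₂, hσ₂, h5⟩ := h.toR hF e₀ (Or.inl rfl : Sg ε ε)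
    obtain ⟨σ₃, hσ₃, h6⟩ := h.allR hc hF e₀ (s e₀) hσ₂
    have hA := hq.trans (h3.trans h4)
    have hB := h5.trans h6
    set T : ℝ × ℝ := (mid (X (s e₀)) (X (s (s e₀))), Y (s e₀) + ε) with hT
    have hT0 : up s X Y T = 0 := by
      by_contra hne
      obtain ⟨-, -, ⟨i, hi⟩, -⟩ := up_box s X Y hne
      have := htop' i
      simp only [hT] at hi
      linarith
    have hTr : ∀ t, T.2 ≤ t → (T.1, t) ∉ bdry s X Y := by
      rintro t ht ⟨i, ⟨h1, h2⟩ | ⟨h1, h2⟩⟩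
      · simp only [hT] at h1 ht
        linarith [htop' i]
      · simp only [hT] at h2 ht
        rw [mem_uIcc] at h2
        rcases h2 with h2 | h2 <;> linarith [htop' i, htop' (s i)]
    have hj := h.jump e₀ (y := mid (Y e₀) (Y (s e₀))) (δ := ε) (by
      rcases h.mid_inner e₀ with hm | hm
      · left; constructor <;> linarith
      · right; constructor <;> linarith) he le_rfl
    simp only [Prod.mk.injEq] at hA hB
    by_cases hs : σ₁ = σ₃
    · rw [hA.1, hs, ← hB.1] at hb
      exact ray_unbounded hTr hb
    · rw [h0] at hA
      rw [hT0] at hB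
      rcases hσ₁ with rfl | rfl <;> rcases hσ₃ with rfl | rfl
      · exact hs rfl
      · rw [← hA.2, ← hB.2] at hj; exact absurd hj (by decide)
      · rw [← hA.2, ← hB.2] at hj; exact absurd hj (by decide)
      · exact hs rfl
  · intro h1
    have hsub : connectedComponentIn (bdry s X Y)ᶜ p ⊆ {p | p ∉ bdry s X Y ∧ up s X Y p = 1} := by
      refine isPreconnected_connectedComponentIn.subset_left_of_subset_union
        (isOpen_val s X Y 1) (isOpen_val s X Y 0) ?_ ?_ ?_
      · rw [Set.disjoint_left]
        rintro q ⟨_, h2⟩ ⟨_, h3⟩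
        rw [h2] at h3
        exact absurd h3 (by decide)
      · intro q hq
        have := connectedComponentIn_subset _ _ hq
        rcases zcases (up s X Y q) with h2 | h2
        · exact Or.inr ⟨this, h2⟩
        · exact Or.inl ⟨this, h2⟩
      · exact ⟨p, mem_connectedComponentIn hp, hp, h1⟩
    obtain ⟨a, ha⟩ := Finite.exists_min X
    obtain ⟨b, hb⟩ := Finite.exists_max X
    obtain ⟨c, hc⟩ := Finite.exists_min Y
    obtain ⟨d, hd⟩ := Finite.exists_max Y
    refine (Metric.isBounded_Icc (X a, Y c) (X b, Y d)).subset fun q hq => ?_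
    have := (hsub hq).2
    obtain ⟨⟨i, hi⟩, ⟨j, hj⟩, ⟨k, hk⟩, ⟨l, hl⟩⟩ := up_box s X Y (p := q) (by rw [this]; decide)
    refine ⟨⟨?_, ?_⟩, ?_, ?_⟩ <;> dsimp only
    · linarith [ha j]
    · linarith [hc l]
    · linarith [hb i]
    · linarith [hd k]

end RPoly
namespace RPoly
open Set
set_option linter.unusedSectionVars false
variable {ι : Type} [Fintype ι]
variable {s : Equiv.Perm ι} {X Y : ι → ℝ} {ε : ℝ}

/-- edge `e` has an end with height in `[Y b, Y a]` -/
def Kv (s : Equiv.Perm ι) (Y : ι → ℝ) (a b e : ι) : Prop :=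
  Y e ∈ Icc (Y b) (Y a) ∨ Y (s e) ∈ Icc (Y b) (Y a)

/-- trapezoid with ceiling `a`, floor `b`, left and right vertical edges `l`, `r`. -/
structure Trap (s : Equiv.Perm ι) (X Y : ι → ℝ) (a b l r : ι) : Prop where
  ylt : Y b < Y a
  xlt : X (s l) < X (s r)
  vl : Kv s Y a b l
  vr : Kv s Y a b r
  al : X (s l) ∈ uIcc (X a) (X (s a))
  ar : X (s r) ∈ uIcc (X a) (X (s a))
  bl : X (s l) ∈ uIcc (X b) (X (s b))
  br : X (s r) ∈ uIcc (X b) (X (s b))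
  box : ∀ x ∈ Ioo (X (s l)) (X (s r)), ∀ y ∈ Ioo (Y b) (Y a),
    (x, y) ∉ bdry s X Y ∧ up s X Y (x, y) = 1

theorem Trap.spanA {a b l r : ι} (h : Trap s X Y a b l r) {x : ℝ}
    (hx : x ∈ Ioo (X (s l)) (X (s r))) : x ∈ uIcc (X a) (X (s a)) :=
  ordConnected_uIcc.out h.al h.ar (Ioo_subset_Icc_self hx)

theorem Trap.spanB {a b l r : ι} (h : Trap s X Y a b l r) {x : ℝ}
    (hx : x ∈ Ioo (X (s l)) (X (s r))) : x ∈ uIcc (X b) (X (s b)) :=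
  ordConnected_uIcc.out h.bl h.br (Ioo_subset_Icc_self hx)

theorem not_end {u w lo hi : ℝ} (hl : lo ∈ uIcc u w) (hh : hi ∈ uIcc u w) :
    u ∉ Ioo lo hi ∧ w ∉ Ioo lo hi := by
  rw [mem_uIcc] at hl hh
  constructor <;> rintro ⟨h1, h2⟩ <;> rcases hl with hl | hl <;> rcases hh with hh | hh <;> linarith

theorem Trap.vtx_out (h : RP s X Y ε) {a b l r e : ι} (ht : Trap s X Y a b l r)
    (he : Kv s Y a b e) : X (s e) ∉ Ioo (X (s l)) (X (s r)) := by
  intro hx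
  have key : ∀ k, (k = e ∨ k = s e) → Y k ∈ Icc (Y b) (Y a) → False := by
    intro k hk hy
    have hB : (X (s e), Y k) ∈ bdry s X Y := by
      refine ⟨e, Or.inr ⟨rfl, ?_⟩⟩
      rcases hk with rfl | rfl
      · exact left_mem_uIcc
      · exact right_mem_uIcc
    have hend : ∀ c, k = c → X (s l) ∈ uIcc (X c) (X (s c)) → X (s r) ∈ uIcc (X c) (X (s c)) →
        False := by
      rintro c rfl h1 h2
      obtain ⟨h3, h4⟩ := not_end h1 h2
      rcases hk with rfl | rfl
      · exact h4 hx
      · exact h3 hx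
    rcases hy.1.eq_or_lt with h1 | h1
    · exact hend b (h.injY h1.symm) ht.bl ht.br
    rcases hy.2.eq_or_lt with h2 | h2
    · exact hend a (h.injY h2) ht.al ht.ar
    exact (ht.box _ hx _ ⟨h1, h2⟩).1 hB
  rcases he with he | he
  · exact key e (Or.inl rfl) he
  · exact key (s e) (Or.inr rfl) he

theorem Trap.uniq_y {a b l r a' b' l' r' : ι} (h1 : Trap s X Y a b l r)
    (h2 : Trap s X Y a' b' l' r') {x y : ℝ} (hx : x ∈ Ioo (X (s l)) (X (s r)))
    (hy : y ∈ Ioo (Y b) (Y a)) (hx' : x ∈ Ioo (X (s l')) (X (s r')))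
    (hy' : y ∈ Ioo (Y b') (Y a')) : Y a' ≤ Y a ∧ Y b ≤ Y b' := by
  constructor <;> by_contra! hc
  · refine (h2.box x hx' (Y a) ⟨by linarith [hy.2, hy'.1], hc⟩).1 ⟨a, Or.inl ⟨rfl, h1.spanA hx⟩⟩
  · refine (h2.box x hx' (Y b) ⟨hc, by linarith [hy.1, hy'.2]⟩).1 ⟨b, Or.inl ⟨rfl, h1.spanB hx⟩⟩

theorem Trap.uniq (h : RP s X Y ε) {a b l r a' b' l' r' : ι} (h1 : Trap s X Y a b l r)
    (h2 : Trap s X Y a' b' l' r') {x y : ℝ} (hx : x ∈ Ioo (X (s l)) (X (s r)))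
    (hy : y ∈ Ioo (Y b) (Y a)) (hx' : x ∈ Ioo (X (s l')) (X (s r')))
    (hy' : y ∈ Ioo (Y b') (Y a')) : a = a' ∧ b = b' ∧ l = l' ∧ r = r' := by
  obtain ⟨u1, u2⟩ := h1.uniq_y h2 hx hy hx' hy'
  obtain ⟨u3, u4⟩ := h2.uniq_y h1 hx' hy' hx hy
  have ha := h.injY (le_antisymm u3 u1)
  have hb := h.injY (le_antisymm u2 u4)
  subst ha hb
  have e1 := h1.vtx_out h h2.vl
  have e2 := h1.vtx_out h h2.vr
  have e3 := h2.vtx_out h h1.vl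
  have e4 := h2.vtx_out h h1.vr
  simp only [mem_Ioo, not_and, not_lt] at e1 e2 e3 e4 hx hx'
  refine ⟨rfl, rfl, s.injective (h.injX (le_antisymm ?_ ?_)), s.injective (h.injX (le_antisymm ?_ ?_))⟩
  · by_contra! hc
    linarith [e3 hc]
  · by_contra! hc
    linarith [e1 hc]
  · by_contra! hc
    have := e2 (by linarith); linarith
  · by_contra! hc
    have := e4 (by linarith); linarith

theorem up_above {x y : ℝ} (h1 : up s X Y (x, y) = 1) :
    ∃ i, x ∈ uIcc (X i) (X (s i)) ∧ y < Y i := by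
  by_contra! hc
  have : up s X Y (x, y) = 0 := by
    refine Finset.sum_eq_zero fun i _ => ?_
    by_cases h0 : lt01 x (X i) + lt01 x (X (s i)) = 0
    · dsimp only; rw [h0, zero_mul]
    · have := hc i (lt01_add_mem h0)
      simp [lt01, not_lt.2 this]
  rw [this] at h1
  exact absurd h1 (by decide)

theorem up_below {x y : ℝ} (h1 : up s X Y (x, y) = 1) :
    ∃ i, x ∈ uIcc (X i) (X (s i)) ∧ Y i ≤ y := by
  by_contra! hc
  have : up s X Y (x, y) = ∑ i, (lt01 x (X i) + lt01 x (X (s i))) := by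
    refine Finset.sum_congr rfl fun i _ => ?_
    by_cases h0 : lt01 x (X i) + lt01 x (X (s i)) = 0
    · dsimp only; rw [h0, zero_mul]
    · have := hc i (lt01_add_mem h0)
      simp [lt01, this]
  rw [this, Finset.sum_add_distrib, Equiv.sum_comp s (fun i => lt01 x (X i)), zadd] at h1
  exact absurd h1 (by decide)

theorem RP.exists_trap (h : RP s X Y ε) {x y : ℝ} (hg : ∀ i, x ≠ X i)
    (hp : (x, y) ∉ bdry s X Y) (h1 : up s X Y (x, y) = 1) :
    ∃ a b l r, Trap s X Y a b l r ∧ x ∈ Ioo (X (s l)) (X (s r)) ∧ y ∈ Ioo (Y b) (Y a) := by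
  classical
  obtain ⟨i0, hi0⟩ := up_above h1
  obtain ⟨j0, hj0⟩ := up_below h1
  obtain ⟨a, ha, hmin⟩ := Finset.exists_min_image
      (Finset.univ.filter fun i => x ∈ uIcc (X i) (X (s i)) ∧ y < Y i) Y ⟨i0, by simpa using hi0⟩
  obtain ⟨b, hb, hmax⟩ := Finset.exists_max_image
      (Finset.univ.filter fun i => x ∈ uIcc (X i) (X (s i)) ∧ Y i ≤ y) Y ⟨j0, by simpa using hj0⟩
  simp only [Finset.mem_filter, Finset.mem_univ, true_and] at ha hmin hb hmax
  have hby : Y b < y := lt_of_le_of_ne hb.2 fun hc => hp ⟨b, Or.inl ⟨hc.symm, hb.1⟩⟩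
  have hab : Y b < Y a := hby.trans ha.2
  have hbet : ∀ i, x ∈ uIcc (X i) (X (s i)) → Y i ∉ Ioo (Y b) (Y a) := by
    rintro i hi ⟨h2, h3⟩
    rcases lt_or_ge y (Y i) with h4 | h4
    · linarith [hmin i ⟨hi, h4⟩]
    · linarith [hmax i ⟨hi, h4⟩]
  have hKa : ∀ e, (e = a ∨ s e = a) → Kv s Y a b e := by
    rintro e (rfl | rfl)
    · exact Or.inl ⟨hab.le, le_rfl⟩
    · exact Or.inr ⟨hab.le, le_rfl⟩
  have hKb : ∀ e, (e = b ∨ s e = b) → Kv s Y a b e := by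
    rintro e (rfl | rfl)
    · exact Or.inl ⟨le_rfl, hab.le⟩
    · exact Or.inr ⟨le_rfl, hab.le⟩
  have hends : ∀ c, x ∈ uIcc (X c) (X (s c)) → (X c < x ∧ x < X (s c)) ∨ (X (s c) < x ∧ x < X c) := by
    intro c hc
    rcases mem_uIcc.1 hc with h2 | h2
    · left; exact ⟨lt_of_le_of_ne h2.1 (hg _).symm, lt_of_le_of_ne h2.2 (hg _)⟩
    · right; exact ⟨lt_of_le_of_ne h2.1 (hg _).symm, lt_of_le_of_ne h2.2 (hg _)⟩
  have hs1 : s (s.symm a) = a := s.apply_symm_apply a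
  have hLne : ∃ e, Kv s Y a b e ∧ X (s e) < x := by
    rcases hends a ha.1 with h2 | h2
    · exact ⟨s.symm a, hKa _ (Or.inr hs1), by rw [hs1]; exact h2.1⟩
    · exact ⟨a, hKa _ (Or.inl rfl), h2.1⟩
  have hRne : ∃ e, Kv s Y a b e ∧ x < X (s e) := by
    rcases hends a ha.1 with h2 | h2
    · exact ⟨a, hKa _ (Or.inl rfl), h2.2⟩
    · exact ⟨s.symm a, hKa _ (Or.inr hs1), by rw [hs1]; exact h2.2⟩
  obtain ⟨l0, hl0⟩ := hLne
  obtain ⟨r0, hr0⟩ := hRne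
  obtain ⟨l, hl, hlmax⟩ := Finset.exists_max_image
      (Finset.univ.filter fun e => Kv s Y a b e ∧ X (s e) < x) (fun e => X (s e)) ⟨l0, by simpa using hl0⟩
  obtain ⟨r, hr, hrmin⟩ := Finset.exists_min_image
      (Finset.univ.filter fun e => Kv s Y a b e ∧ x < X (s e)) (fun e => X (s e)) ⟨r0, by simpa using hr0⟩
  simp only [Finset.mem_filter, Finset.mem_univ, true_and] at hl hlmax hr hrmin
  have hout : ∀ e, Kv s Y a b e → X (s e) ≤ X (s l) ∨ X (s r) ≤ X (s e) := by
    intro e he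
    rcases lt_or_gt_of_ne (hg (s e)) with h2 | h2
    · exact Or.inr (hrmin e ⟨he, h2⟩)
    · exact Or.inl (hlmax e ⟨he, h2⟩)
  have hspan : ∀ c, x ∈ uIcc (X c) (X (s c)) → (∀ e, (e = c ∨ s e = c) → Kv s Y a b e) →
      X (s l) ∈ uIcc (X c) (X (s c)) ∧ X (s r) ∈ uIcc (X c) (X (s c)) := by
    intro c hc hK
    have o1 := hout c (hK c (Or.inl rfl))
    have o2 := hout (s.symm c) (hK _ (Or.inr (s.apply_symm_apply c)))
    rw [s.apply_symm_apply] at o2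
    rw [mem_uIcc, mem_uIcc]
    have := hl.2
    have := hr.2
    rcases hends c hc with h2 | h2
    · constructor <;> left <;> rcases o1 with o1 | o1 <;> rcases o2 with o2 | o2 <;> constructor <;>
        linarith
    · constructor <;> right <;> rcases o1 with o1 | o1 <;> rcases o2 with o2 | o2 <;> constructor <;>
        linarith
  obtain ⟨sa1, sa2⟩ := hspan a ha.1 hKa
  obtain ⟨sb1, sb2⟩ := hspan b hb.1 hKb
  have hxl : x ∈ Ioo (X (s l)) (X (s r)) := ⟨hl.2, hr.2⟩
  have hbox : ∀ x' ∈ Ioo (X (s l)) (X (s r)), ∀ y' ∈ Ioo (Y b) (Y a), (x', y') ∉ bdry s X Y := by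
    rintro x' hx' y' hy' ⟨i, ⟨h2, h3⟩ | ⟨h2, h3⟩⟩
    · dsimp only at h2 h3
      subst h2
      have hyI := Ioo_subset_Icc_self hy'
      have o1 := hout i (Or.inl hyI)
      have o2 := hout (s.symm i) (Or.inr (by rwa [s.apply_symm_apply]))
      rw [s.apply_symm_apply] at o2
      refine hbet i ?_ hy'
      have := hx'.1
      have := hx'.2
      have := hl.2
      have := hr.2
      rw [mem_uIcc] at h3 ⊢
      rcases h3 with h3 | h3
      · left; rcases o1 with o1 | o1 <;> rcases o2 with o2 | o2 <;> constructor <;> linarith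
      · right; rcases o1 with o1 | o1 <;> rcases o2 with o2 | o2 <;> constructor <;> linarith
    · dsimp only at h2 h3
      subst h2
      have hnK : ¬ Kv s Y a b i := fun hK => by
        rcases hout i hK with h4 | h4
        · linarith [hx'.1]
        · linarith [hx'.2]
      have hc : Y a ∈ uIcc (Y i) (Y (s i)) := by
        simp only [Kv, mem_Icc, not_or, not_and_or, not_le] at hnK
        obtain ⟨n1, n2⟩ := hnK
        have := hy'.1
        have := hy'.2
        rw [mem_uIcc] at h3 ⊢
        rcases h3 with h3 | h3
        · left; rcases n1 with n1 | n1 <;> rcases n2 with n2 | n2 <;> constructor <;> linarith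
        · right; rcases n1 with n1 | n1 <;> rcases n2 with n2 | n2 <;> constructor <;> linarith
      exact hnK (hKa i (h.cross a i (ordConnected_uIcc.out sa1 sa2 (Ioo_subset_Icc_self hx')) hc))
  refine ⟨a, b, l, r, ⟨hab, hl.2.trans hr.2, hl.1, hr.1, sa1, sa2, sb1, sb2, fun x' hx' y' hy' =>
    ⟨hbox x' hx' y' hy', ?_⟩⟩, hxl, hby, ha.2⟩
  rw [← h1]
  exact (inv_up s X Y).box ordConnected_Ioo ordConnected_Ioo hbox ⟨hx', hy'⟩ ⟨hxl, hby, ha.2⟩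

/-- points of vertical edges are limits of odd points -/
theorem RP.approxV (h : RP s X Y ε) (e : ι) {y δ : ℝ} (hy : y ∈ uIcc (Y e) (Y (s e))) (hδ : 0 < δ) :
    ∃ q : ℝ × ℝ, q ∉ bdry s X Y ∧ up s X Y q = 1 ∧ |q.1 - X (s e)| < δ ∧ |q.2 - y| < δ := by
  have he := h.eps
  have hne : Y e ≠ Y (s e) := fun hc => h.ne e (h.injY hc).symm
  obtain ⟨y', hy', hg, hd⟩ : ∃ y', ((Y e < y' ∧ y' < Y (s e)) ∨ (Y (s e) < y' ∧ y' < Y e)) ∧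
      (∀ i, y' ≠ Y i) ∧ |y' - y| < δ := by
    have hlt : max (min (Y e) (Y (s e))) (y - δ) < min (max (Y e) (Y (s e))) (y + δ) := by
      have h1 : min (Y e) (Y (s e)) ≤ y := hy.1
      have h2 : y ≤ max (Y e) (Y (s e)) := hy.2
      rw [max_lt_iff, lt_min_iff, lt_min_iff]
      exact ⟨⟨min_lt_max.2 hne, by linarith⟩, by linarith, by linarith⟩
    obtain ⟨y', h1, h2⟩ := exists_generic Y hlt
    refine ⟨y', ?_, h2, ?_⟩
    · have h3 := (max_lt_iff.1 h1.1).1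
      have h4 := (lt_min_iff.1 h1.2).1
      rcases le_total (Y e) (Y (s e)) with h5 | h5
      · rw [min_eq_left h5] at h3; rw [max_eq_right h5] at h4; exact Or.inl ⟨h3, h4⟩
      · rw [min_eq_right h5] at h3; rw [max_eq_left h5] at h4; exact Or.inr ⟨h3, h4⟩
    · have h3 := (max_lt_iff.1 h1.1).2
      have h4 := (lt_min_iff.1 h1.2).2
      rw [abs_lt]; constructor <;> linarith
  set η := min ε (δ / 2) with hη
  have hη0 : 0 < η := lt_min he (by linarith)
  have hηε : η ≤ ε := min_le_left _ _
  have hηδ : η < δ := lt_of_le_of_lt (min_le_right _ _) (by linarith)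
  have hj := h.jump e hy' hη0 hηε
  have hnB : ∀ σ, Sg η σ → (X (s e) + σ, y') ∉ bdry s X Y := by
    rintro σ hσ ⟨i, ⟨h1, _⟩ | ⟨h1, _⟩⟩
    · exact hg i h1
    · dsimp only at h1
      rcases h.gx (s e) (s i) with h3 | h3 | h3
      · rw [← h3] at h1; rcases hσ with rfl | rfl <;> linarith
      · rcases hσ with h4 | h4 <;> linarith
      · rcases hσ with h4 | h4 <;> linarith
  have hσ : ∃ σ, Sg η σ ∧ up s X Y (X (s e) + σ, y') = 1 := by
    rcases zcases (up s X Y (X (s e) + η, y')) with h1 | h1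
    · rw [h1, add_zero] at hj
      exact ⟨-η, Or.inr rfl, hj⟩
    · exact ⟨η, Or.inl rfl, h1⟩
  obtain ⟨σ, hσ, h1⟩ := hσ
  refine ⟨(X (s e) + σ, y'), hnB σ hσ, h1, ?_, hd⟩
  dsimp only
  rw [add_sub_cancel_left, hσ.abs hη0]
  exact hηδ

theorem RP.approx (h : RP s X Y ε) {p : ℝ × ℝ} (hp : p ∈ bdry s X Y ∨ up s X Y p = 1) {δ : ℝ}
    (hδ : 0 < δ) :
    ∃ q : ℝ × ℝ, q ∉ bdry s X Y ∧ up s X Y q = 1 ∧ |q.1 - p.1| < δ ∧ |q.2 - p.2| < δ := by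
  by_cases hB : p ∈ bdry s X Y
  · obtain ⟨i, ⟨h1, h2⟩ | ⟨h1, h2⟩⟩ := hB
    · obtain ⟨q, q1, q2, q3, q4⟩ := h.swap.approxV (s.symm i) (y := p.1) (δ := δ) (by simpa using h2) hδ
      refine ⟨q.swap, ?_, ?_, ?_, ?_⟩
      · rw [← bdry_swap]; simpa using q1
      · rw [← up_swap]; simpa using q2
      · simpa using q4
      · rw [s.apply_symm_apply] at q3
        rw [h1]; simpa using q3
    · obtain ⟨q, q1, q2, q3, q4⟩ := h.approxV i h2 hδ
      exact ⟨q, q1, q2, by rwa [h1], q4⟩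
  · exact ⟨p, hB, hp.resolve_left hB, by simpa using hδ, by simpa using hδ⟩

theorem RP.cover (h : RP s X Y ε) :
    {p | p ∈ bdry s X Y ∨ up s X Y p = 1} =
      ⋃ t : {t : ι × ι × ι × ι // Trap s X Y t.1 t.2.1 t.2.2.1 t.2.2.2},
        Icc (X (s t.1.2.2.1)) (X (s t.1.2.2.2)) ×ˢ Icc (Y t.1.2.1) (Y t.1.1) := by
  classical
  apply Subset.antisymm
  · intro p hp
    have hcl : IsClosed (⋃ t : {t : ι × ι × ι × ι // Trap s X Y t.1 t.2.1 t.2.2.1 t.2.2.2},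
        Icc (X (s t.1.2.2.1)) (X (s t.1.2.2.2)) ×ˢ Icc (Y t.1.2.1) (Y t.1.1)) :=
      isClosed_iUnion_of_finite fun t => isClosed_Icc.prod isClosed_Icc
    rw [← hcl.closure_eq, Metric.mem_closure_iff]
    intro δ hδ
    obtain ⟨q, q1, q2, q3, q4⟩ := h.approx hp (half_pos hδ)
    obtain ⟨η, hη, hl⟩ := local_const s X Y q1
    have hm : 0 < min η (δ / 2) := lt_min hη (half_pos hδ)
    obtain ⟨x, hx, hg⟩ := exists_generic X (show q.1 < q.1 + min η (δ / 2) by linarith)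
    have m1 := min_le_left η (δ / 2)
    have m2 := min_le_right η (δ / 2)
    obtain ⟨l1, l2⟩ := hl x q.2 (by rw [abs_lt]; constructor <;> linarith [hx.1, hx.2]) (by simpa using hη)
    rw [q2] at l2
    obtain ⟨a, b, l, r, ht, hxx, hyy⟩ := h.exists_trap hg l1 l2
    refine ⟨(x, q.2), mem_iUnion.2 ⟨⟨(a, b, l, r), ht⟩, ⟨Ioo_subset_Icc_self hxx, Ioo_subset_Icc_self hyy⟩⟩, ?_⟩
    rw [dist_comm, Prod.dist_eq, max_lt_iff, Real.dist_eq, Real.dist_eq]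
    constructor
    · rw [abs_lt] at q3 ⊢
      constructor <;> dsimp only <;> linarith [hx.1, hx.2, q3.1, q3.2]
    · dsimp only; linarith
  · refine iUnion_subset fun t => ?_
    have hc : IsClosed {p | p ∈ bdry s X Y ∨ up s X Y p = 1} := by
      rw [← isOpen_compl_iff]
      convert isOpen_val s X Y 0 using 1
      ext p
      simp only [mem_compl_iff, mem_ofPred_eq, not_or]
      refine and_congr_right fun _ => ?_
      rcases zcases (up s X Y p) with h1 | h1 <;> simp [h1]
    have ht := t.2
    rw [← closure_Ioo ht.xlt.ne, ← closure_Ioo ht.ylt.ne, ← closure_prod_eq]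
    refine closure_minimal ?_ hc
    rintro ⟨x, y⟩ ⟨hx, hy⟩
    exact Or.inr (ht.box x hx y hy).2

end RPoly
namespace RPoly
open Set
set_option linter.unusedSectionVars false
variable {ι : Type} [Fintype ι]
variable {s : Equiv.Perm ι} {X Y : ι → ℝ} {ε : ℝ}

/-- vertical chord -/
def chord (x0 y y' : ℝ) : Set (ℝ × ℝ) := {p | p.1 = x0 ∧ p.2 ∈ uIcc y y'}

theorem RP.chordG (i j : ι) (hij : i ≠ j) (s' : Equiv.Perm ι)
    (hj : s' j = i) (hk : ∀ k, k ≠ j → s' k = s k ∨ s' k = k) {x0 : ℝ}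
    (hx : ∀ k, ε < |x0 - X k|) (hi0 : x0 ∈ uIcc (X i) (X (s i)))
    (hj0 : x0 ∈ uIcc (X j) (X (s j))) (he : 0 < ε) :
    ∃ G : ℝ × ℝ → ZMod 2, Inv (bdry s X Y ∪ chord x0 (Y j) (Y i)) G ∧
      ∀ y, (Y i < y ∧ y < Y j) ∨ (Y j < y ∧ y < Y i) → G (x0 - ε, y) + G (x0 + ε, y) = 1 := by
  classical
  have hX' : ∀ k, k ≠ j → Function.update X i x0 (s' k) = X (s' k) := by
    intro k hkj
    apply Function.update_of_ne
    intro hc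
    exact hkj (s'.injective (hc.trans hj.symm))
  refine ⟨up s' (Function.update X i x0) Y, (inv_up s' _ Y).mono ?_, ?_⟩
  · rintro p ⟨k, hp⟩
    by_cases hkj : k = j
    · subst hkj
      rw [hj, Function.update_self, Function.update_of_ne hij.symm] at hp
      rcases hp with ⟨h1, h2⟩ | ⟨h1, h2⟩
      · exact Or.inl ⟨k, Or.inl ⟨h1, uIcc_subset_uIcc left_mem_uIcc hj0 h2⟩⟩
      · exact Or.inr ⟨h1, h2⟩
    · rw [hX' k hkj] at hp
      left
      rcases hk k hkj with h3 | h3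
      · rw [h3] at hp
        rcases hp with ⟨h1, h2⟩ | ⟨h1, h2⟩
        · refine ⟨k, Or.inl ⟨h1, ?_⟩⟩
          by_cases hki : k = i
          · subst hki
            rw [Function.update_self] at h2
            exact uIcc_subset_uIcc hi0 right_mem_uIcc h2
          · rwa [Function.update_of_ne hki] at h2
        · exact ⟨k, Or.inr ⟨h1, h2⟩⟩
      · rw [h3] at hp
        have hki : k ≠ i := by
          rintro rfl
          exact hkj (s'.injective (h3.trans hj.symm))
        rw [Function.update_of_ne hki, uIcc_self, uIcc_self] at hp
        refine ⟨k, Or.inl ?_⟩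
        rcases hp with ⟨h1, h2⟩ | ⟨h1, h2⟩
        · rw [mem_singleton_iff] at h2
          rw [h1, h2]; exact ⟨rfl, left_mem_uIcc⟩
        · rw [mem_singleton_iff] at h2
          rw [h1, h2]; exact ⟨rfl, left_mem_uIcc⟩
  · intro y hy
    have hse : Function.update X i x0 (s' j) = x0 := by rw [hj, Function.update_self]
    refine RPoly.jump s' _ Y j ?_ ?_ ?_ ?_
    · rw [hse]; linarith
    · rw [hse]; linarith
    · intro k hkj
      rw [hX' k hkj]
      have := hx (s' k)
      rcases abs_cases (x0 - X (s' k)) with h1 | h1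
      · constructor <;> intro <;> linarith
      · constructor <;> intro <;> linarith
    · rw [hj]
      apply lt01_between
      rcases hy with hy | hy
      · right; exact ⟨hy.1.le, hy.2⟩
      · left; exact ⟨hy.1.le, hy.2⟩

/-- value of `G` on the interior side of edge `e` -/
noncomputable def fv (s : Equiv.Perm ι) (X Y : ι → ℝ) (ε : ℝ) (G : ℝ × ℝ → ZMod 2) (e : ι) : ZMod 2 :=
  up s X Y (X (s e) + ε, mid (Y e) (Y (s e))) * G (X (s e) + ε, mid (Y e) (Y (s e)))
  + up s X Y (X (s e) + -ε, mid (Y e) (Y (s e))) * G (X (s e) + -ε, mid (Y e) (Y (s e)))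

theorem RP.fv_eq (h : RP s X Y ε) {D : Set (ℝ × ℝ)} (hD : Good s X Y ε D) (hB : bdry s X Y ⊆ D)
    {G : ℝ × ℝ → ZMod 2} (hG : Inv D G) {e c f g : ι} (hv : Vtx s e c f g) {a b : ℝ}
    (ha : Sg ε a) (hb : Sg ε b) (h1 : up s X Y (X (s e) + a, Y c + b) = 1) :
    fv s X Y ε G e = G (X (s e) + a, Y c + b) := by
  have he := h.eps
  have hm := h.mid_inner e
  obtain ⟨σ, hσ, hq⟩ := h.quad hD (((inv_up s X Y).mono hB).prod hG) hv ha hb hm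
  rw [Prod.mk.injEq] at hq
  obtain ⟨q1, q2⟩ := hq
  have hj := h.jump e (y := mid (Y e) (Y (s e))) (δ := ε) (by
    rcases hm with hm | hm
    · left; constructor <;> linarith
    · right; constructor <;> linarith) he le_rfl
  rw [h1] at q1
  rw [q2]
  unfold fv
  rcases hσ with rfl | rfl
  · rw [← q1] at hj ⊢
    rw [add_eq_right] at hj
    rw [hj]; ring
  · rw [← q1] at hj ⊢
    rw [add_eq_left] at hj
    rw [hj]; ring

theorem RP.fv_trap (h : RP s X Y ε) {D : Set (ℝ × ℝ)} (hD : Good s X Y ε D) (hB : bdry s X Y ⊆ D)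
    {G : ℝ × ℝ → ZMod 2} (hG : Inv D G) {a b l r e : ι} (ht : Trap s X Y a b l r)
    (hv : Kv s Y a b e) {σ : ℝ} (hσ : Sg ε σ) (hin : X (s e) + σ ∈ Ioo (X (s l)) (X (s r))) :
    ∃ y ∈ Ioo (Y b) (Y a), fv s X Y ε G e = G (X (s e) + σ, y) := by
  have he := h.eps
  have hlt := ht.ylt
  have key : ∀ c f g, Vtx s e c f g → Y c ∈ Icc (Y b) (Y a) →
      ∃ y ∈ Ioo (Y b) (Y a), fv s X Y ε G e = G (X (s e) + σ, y) := by
    intro c f g hv hc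
    have : ∃ τ, Sg ε τ ∧ Y c + τ ∈ Ioo (Y b) (Y a) := by
      rcases h.gy c a with h1 | h1 | h1
      · subst h1
        rcases h.gy c b with h2 | h2 | h2
        · subst h2; linarith
        · linarith
        · exact ⟨-ε, Or.inr rfl, by constructor <;> linarith⟩
      · exact ⟨ε, Or.inl rfl, by constructor <;> linarith [hc.1]⟩
      · linarith [hc.2]
    obtain ⟨τ, h1, h2⟩ := this
    exact ⟨_, h2, h.fv_eq hD hB hG hv hσ h1 (ht.box _ hin _ h2).2⟩
  rcases hv with h1 | h1
  · exact key e _ _ (Or.inl ⟨rfl, rfl, rfl⟩) h1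
  · exact key (s e) _ _ (Or.inr ⟨rfl, rfl, rfl⟩) h1

/-- splitting permutations -/
def HSplit (s : Equiv.Perm ι) : Prop := ∀ a b, a ≠ b → ∃ s' : Equiv.Perm ι,
  (s' b = a ∧ ∀ k, k ≠ b → s' k = s k ∨ s' k = k) ∨
  (s' a = b ∧ ∀ k, k ≠ a → s' k = s k ∨ s' k = k)

theorem Trap.gap (h : RP s X Y ε) {a b l r : ι} (ht : Trap s X Y a b l r) :
    X (s l) + 4 * ε < X (s r) := by
  have := ht.xlt
  have he := h.eps
  rcases h.gx (s l) (s r) with h1 | h1 | h1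
  · rw [h1] at this; linarith
  · exact h1
  · linarith

theorem RP.dual (h : RP s X Y ε) (hs : HSplit s) {a b l r : ι} (ht : Trap s X Y a b l r) :
    ∃ f : ι → ZMod 2, f l + f r = 1 ∧ ∀ a' b' l' r', Trap s X Y a' b' l' r' →
      ¬ (a = a' ∧ b = b' ∧ l = l' ∧ r = r') → f l' + f r' = 0 := by
  have he := h.eps
  have hgap := ht.gap h
  have hlt := ht.ylt
  set x0 := X (s l) + 2 * ε with hx0
  have hx0m : x0 ∈ Ioo (X (s l)) (X (s r)) := by constructor <;> linarith
  have hxg : ∀ k, ε < |x0 - X k| := by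
    intro k
    rw [lt_abs]
    rcases h.gx (s l) k with h1 | h1 | h1
    · rw [← h1]; left; linarith
    · right; linarith
    · left; linarith
  have hab : a ≠ b := by rintro rfl; exact lt_irrefl _ hlt
  have hA := ht.spanA hx0m
  have hB := ht.spanB hx0m
  obtain ⟨G, hG, hGj⟩ : ∃ G : ℝ × ℝ → ZMod 2, Inv (bdry s X Y ∪ chord x0 (Y b) (Y a)) G ∧
      ∀ y ∈ Ioo (Y b) (Y a), G (x0 - ε, y) + G (x0 + ε, y) = 1 := by
    obtain ⟨s', hs' | hs'⟩ := hs a b hab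
    · obtain ⟨G, h1, h2⟩ := RP.chordG (Y := Y) a b hab s' hs'.1 hs'.2 hxg hA hB he
      exact ⟨G, h1, fun y hy => h2 y (Or.inr hy)⟩
    · obtain ⟨G, h1, h2⟩ := RP.chordG (Y := Y) b a hab.symm s' hs'.1 hs'.2 hxg hB hA he
      refine ⟨G, ?_, fun y hy => h2 y (Or.inl hy)⟩
      unfold chord at h1 ⊢
      rwa [uIcc_comm] at h1
  set D := bdry s X Y ∪ chord x0 (Y b) (Y a) with hDdef
  have hBD : bdry s X Y ⊆ D := subset_union_left
  have hD : Good s X Y ε D := by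
    rintro p (hp | hp) hq k
    · exact absurd hp hq
    · rw [hp.1]; exact hxg k
  have hchord : ∀ x y, (x, y) ∈ chord x0 (Y b) (Y a) → x = x0 ∧ Y b ≤ y ∧ y ≤ Y a := by
    rintro x y ⟨h1, h2⟩
    rw [uIcc_of_le hlt.le] at h2
    exact ⟨h1, h2⟩
  refine ⟨fv s X Y ε G, ?_, ?_⟩
  · obtain ⟨y, hy, e1⟩ := h.fv_trap hD hBD hG ht ht.vl (Or.inl rfl)
      (by constructor <;> linarith)
    obtain ⟨y', hy', e2⟩ := h.fv_trap hD hBD hG ht ht.vr (Or.inr rfl)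
      (by constructor <;> linarith)
    rw [e1, e2]
    have b1 : G (X (s l) + ε, y) = G (x0 - ε, y) := by
      refine hG.box (I := Ioo (X (s l)) x0) (J := Ioo (Y b) (Y a)) ordConnected_Ioo ordConnected_Ioo
        ?_ ⟨by constructor <;> dsimp only <;> linarith, hy⟩ ⟨by constructor <;> dsimp only <;> linarith, hy⟩
      rintro u hu w hw (hc | hc)
      · exact (ht.box u ⟨hu.1, hu.2.trans hx0m.2⟩ w hw).1 hc
      · linarith [(hchord _ _ hc).1, hu.2]
    have b2 : G (X (s r) + -ε, y') = G (x0 + ε, y) := by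
      refine hG.box (I := Ioo x0 (X (s r))) (J := Ioo (Y b) (Y a)) ordConnected_Ioo ordConnected_Ioo
        ?_ ⟨by constructor <;> dsimp only <;> linarith, hy'⟩ ⟨by constructor <;> dsimp only <;> linarith, hy⟩
      rintro u hu w hw (hc | hc)
      · exact (ht.box u ⟨hx0m.1.trans hu.1, hu.2⟩ w hw).1 hc
      · linarith [(hchord _ _ hc).1, hu.1]
    rw [b1, b2]
    exact hGj y hy
  · intro a' b' l' r' ht' hne
    have hgap' := ht'.gap h
    obtain ⟨y, hy, e1⟩ := h.fv_trap hD hBD hG ht' ht'.vl (Or.inl rfl)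
      (by constructor <;> linarith)
    obtain ⟨y', hy', e2⟩ := h.fv_trap hD hBD hG ht' ht'.vr (Or.inr rfl)
      (by constructor <;> linarith)
    rw [e1, e2]
    have b1 : G (X (s l') + ε, y) = G (X (s r') + -ε, y') := by
      refine hG.box (I := Ioo (X (s l')) (X (s r'))) (J := Ioo (Y b') (Y a')) ordConnected_Ioo
        ordConnected_Ioo ?_ ⟨by constructor <;> dsimp only <;> linarith, hy⟩
        ⟨by constructor <;> dsimp only <;> linarith, hy'⟩
      rintro u hu w hw (hc | hc)
      · exact (ht'.box u hu w hw).1 hc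
      · obtain ⟨c1, c2, c3⟩ := hchord _ _ hc
        have hnb := (ht'.box u hu w hw).1
        rcases c2.eq_or_lt with c2 | c2
        · exact hnb ⟨b, Or.inl ⟨c2.symm, c1 ▸ hB⟩⟩
        rcases c3.eq_or_lt with c3 | c3
        · exact hnb ⟨a, Or.inl ⟨c3, c1 ▸ hA⟩⟩
        exact hne (ht.uniq h ht' (c1 ▸ hx0m) ⟨c2, c3⟩ hu hw)
    rw [b1, zadd]

theorem hsum [DecidableEq ι] (c : ZMod 2) (l r : ι) (f : ι → ZMod 2) :
    ∑ i, c * ((Pi.single l 1 : ι → ZMod 2) i + (Pi.single r 1 : ι → ZMod 2) i) * f i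
      = c * (f l + f r) := by
  have h2 : ∀ i, c * ((Pi.single l 1 : ι → ZMod 2) i + (Pi.single r 1 : ι → ZMod 2) i) * f i
      = c * ((if i = l then f i else 0) + (if i = r then f i else 0)) := by
    intro i
    simp only [Pi.single_apply]
    split_ifs <;> ring
  simp only [h2, ← Finset.mul_sum, Finset.sum_add_distrib]
  simp

theorem RP.card_le (h : RP s X Y ε) (hs : HSplit s)
    [Fintype {t : ι × ι × ι × ι // Trap s X Y t.1 t.2.1 t.2.2.1 t.2.2.2}] :
    Fintype.card {t : ι × ι × ι × ι // Trap s X Y t.1 t.2.1 t.2.2.1 t.2.2.2} ≤ Fintype.card ι := by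
  classical
  have : ∀ t : {t : ι × ι × ι × ι // Trap s X Y t.1 t.2.1 t.2.2.1 t.2.2.2},
      ∃ f : ι → ZMod 2, f t.1.2.2.1 + f t.1.2.2.2 = 1 ∧
        ∀ t' : {t : ι × ι × ι × ι // Trap s X Y t.1 t.2.1 t.2.2.1 t.2.2.2}, t' ≠ t →
          f t'.1.2.2.1 + f t'.1.2.2.2 = 0 := by
    rintro ⟨⟨a, b, l, r⟩, ht⟩
    obtain ⟨f, h1, h2⟩ := h.dual hs ht
    refine ⟨f, h1, ?_⟩
    rintro ⟨⟨a', b', l', r'⟩, ht'⟩ hne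
    refine h2 a' b' l' r' ht' ?_
    rintro ⟨rfl, rfl, rfl, rfl⟩
    exact hne rfl
  choose f hf1 hf2 using this
  have : Fact (Nat.Prime 2) := ⟨Nat.prime_two⟩
  have hli : LinearIndependent (ZMod 2)
      (fun t : {t : ι × ι × ι × ι // Trap s X Y t.1 t.2.1 t.2.2.1 t.2.2.2} =>
        (Pi.single t.1.2.2.1 1 + Pi.single t.1.2.2.2 1 : ι → ZMod 2)) := by
    rw [Fintype.linearIndependent_iff]
    intro c hc t
    have h1 := congrArg (fun u : ι → ZMod 2 => ∑ i, u i * f t i) hc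
    simp only [Finset.sum_apply, Pi.smul_apply, Pi.add_apply, smul_eq_mul, Pi.zero_apply, zero_mul,
      Finset.sum_const_zero, Finset.sum_mul] at h1
    rw [Finset.sum_comm, Finset.sum_eq_single t] at h1
    · rw [hsum, hf1, mul_one] at h1
      exact h1
    · intro t' _ hne
      rw [hsum, hf2 t t' hne, mul_zero]
    · intro h0; exact absurd (Finset.mem_univ _) h0
  have := hli.fintype_card_le_finrank
  rwa [Module.finrank_fintype_fun_eq_card] at this

end RPoly
namespace RPoly
open Set

/-- `R` is a union of a `κ`-family of nonoverlapping rectangles -/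
def Pack (κ : Type) (R : Set (ℝ × ℝ)) : Prop :=
  ∃ c d : κ → ℝ × ℝ, (∀ i, (c i).1 < (d i).1 ∧ (c i).2 < (d i).2) ∧
    R = ⋃ i, Icc (c i).1 (d i).1 ×ˢ Icc (c i).2 (d i).2 ∧
    ∀ i j, i ≠ j → ∀ x y, x ∈ Ioo (c i).1 (d i).1 → y ∈ Ioo (c i).2 (d i).2 →
      x ∈ Ioo (c j).1 (d j).1 → y ∈ Ioo (c j).2 (d j).2 → False

theorem Pack.equiv {κ κ' : Type} {R : Set (ℝ × ℝ)} (h : Pack κ R) (e : κ' ≃ κ) : Pack κ' R := by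
  obtain ⟨c, d, h1, h2, h3⟩ := h
  refine ⟨c ∘ e, d ∘ e, fun i => h1 _, ?_, fun i j hij => h3 _ _ fun hc => hij (e.injective hc)⟩
  rw [h2]
  exact (e.surjective.iUnion_comp (fun i => Icc (c i).1 (d i).1 ×ˢ Icc (c i).2 (d i).2)).symm

theorem Pack.option {κ : Type} {R : Set (ℝ × ℝ)} (h : Pack κ R) (k : κ) : Pack (Option κ) R := by
  classical
  obtain ⟨c, d, h1, h2, h3⟩ := h
  obtain ⟨m, hm1, hm2⟩ := exists_between (h1 k).1
  let C : Option κ → ℝ × ℝ := fun o => o.elim (m, (c k).2) c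
  let D : Option κ → ℝ × ℝ := fun o => o.elim (d k) fun i => if i = k then (m, (d k).2) else d i
  have hk : D (some k) = (m, (d k).2) := if_pos rfl
  have hnk : ∀ i, i ≠ k → D (some i) = d i := fun i hi => if_neg hi
  refine ⟨C, D, ?_, ?_, ?_⟩
  · rintro (_ | i)
    · exact ⟨hm2, (h1 k).2⟩
    · by_cases hi : i = k
      · subst hi; rw [hk]; exact ⟨hm1, (h1 i).2⟩
      · rw [hnk i hi]; exact h1 i
  · rw [h2]
    ext p
    simp only [mem_iUnion, mem_prod]
    constructor
    · rintro ⟨i, hi⟩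
      by_cases hik : i = k
      · subst hik
        rcases le_total p.1 m with h4 | h4
        · refine ⟨some i, ?_⟩
          rw [hk]
          exact ⟨⟨hi.1.1, h4⟩, hi.2⟩
        · exact ⟨none, ⟨h4, hi.1.2⟩, hi.2⟩
      · refine ⟨some i, ?_⟩
        rw [hnk i hik]; exact hi
    · rintro ⟨_ | i, hi⟩
      · exact ⟨k, ⟨hm1.le.trans hi.1.1, hi.1.2⟩, hi.2⟩
      · by_cases hik : i = k
        · subst hik
          rw [hk] at hi
          exact ⟨i, ⟨hi.1.1, hi.1.2.trans hm2.le⟩, hi.2⟩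
        · rw [hnk i hik] at hi
          exact ⟨i, hi⟩
  · have key : ∀ i x y, x ∈ Ioo (C (some i)).1 (D (some i)).1 → y ∈ Ioo (C (some i)).2 (D (some i)).2 →
        x ∈ Ioo (c i).1 (d i).1 ∧ y ∈ Ioo (c i).2 (d i).2 ∧ (i = k → x < m) := by
      intro i x y hx hy
      by_cases hik : i = k
      · subst hik
        rw [hk] at hx hy
        exact ⟨⟨hx.1, hx.2.trans hm2⟩, hy, fun _ => hx.2⟩
      · rw [hnk i hik] at hx hy
        exact ⟨hx, hy, fun h => absurd h hik⟩
    have key2 : ∀ i x y, x ∈ Ioo (C (some i)).1 (D (some i)).1 → y ∈ Ioo (C (some i)).2 (D (some i)).2 →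
        x ∈ Ioo (C none).1 (D none).1 → y ∈ Ioo (C none).2 (D none).2 → False := by
      intro i x y hx hy hx' hy'
      obtain ⟨k1, k2, k3⟩ := key i x y hx hy
      by_cases hik : i = k
      · exact lt_asymm (k3 hik) hx'.1
      · exact h3 i k hik x y k1 k2 ⟨hm1.trans hx'.1, hx'.2⟩ hy'
    rintro (_ | i) (_ | j) hij x y hx hy hx' hy'
    · exact hij rfl
    · exact key2 j x y hx' hy' hx hy
    · exact key2 i x y hx hy hx' hy'
    · obtain ⟨k1, k2, k3⟩ := key i x y hx hy
      obtain ⟨l1, l2, l3⟩ := key j x y hx' hy'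
      exact h3 i j (fun hc => hij (congrArg some hc)) x y k1 k2 l1 l2

theorem Pack.grow {R : Set (ℝ × ℝ)} {N n : ℕ} (h0 : 0 < N) (hN : N ≤ n) (h : Pack (Fin N) R) :
    Pack (Fin n) R := by
  induction n, hN using Nat.le_induction with
  | base => exact h
  | succ m hm ih => exact (ih.option ⟨0, by omega⟩).equiv (finSuccEquiv m)

variable {ι : Type} [Fintype ι]
variable {s : Equiv.Perm ι} {X Y : ι → ℝ} {ε : ℝ}

theorem RP.pack (h : RP s X Y ε) (hc : Cyc s) (hs : HSplit s) [Nonempty ι] {n : ℕ}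
    (hn : Fintype.card ι = n) : Pack (Fin n) (boundedRegion (bdry s X Y)) := by
  classical
  have hp : Pack {t : ι × ι × ι × ι // Trap s X Y t.1 t.2.1 t.2.2.1 t.2.2.2}
      (boundedRegion (bdry s X Y)) := by
    refine ⟨fun t => (X (s t.1.2.2.1), Y t.1.2.1), fun t => (X (s t.1.2.2.2), Y t.1.1),
      fun t => ⟨t.2.xlt, t.2.ylt⟩, ?_, ?_⟩
    · rw [h.region hc, h.cover]
    · rintro ⟨⟨a, b, l, r⟩, ht⟩ ⟨⟨a', b', l', r'⟩, ht'⟩ hne x y hx hy hx' hy'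
      obtain ⟨rfl, rfl, rfl, rfl⟩ := ht.uniq h ht' hx hy hx' hy'
      exact hne rfl
  have hne : Nonempty {t : ι × ι × ι × ι // Trap s X Y t.1 t.2.1 t.2.2.1 t.2.2.2} := by
    obtain ⟨i⟩ := ‹Nonempty ι›
    have h1 : (X i, Y i) ∈ {p | p ∈ bdry s X Y ∨ up s X Y p = 1} :=
      Or.inl ⟨i, Or.inl ⟨rfl, left_mem_uIcc⟩⟩
    rw [h.cover, mem_iUnion] at h1
    exact ⟨h1.choose⟩
  have hle := h.card_le hs
  rw [hn] at hle
  exact (hp.equiv (Fintype.equivFin _).symm).grow Fintype.card_pos hle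

theorem nextIdx_val {m : ℕ} (i : Fin m) : ((nextIdx i : Fin m) : ℕ) = ((i : ℕ) + 1) % m := rfl

theorem nextIdx_cases {m : ℕ} (i : Fin m) :
    ((i : ℕ) + 1 < m ∧ ((nextIdx i : Fin m) : ℕ) = (i : ℕ) + 1) ∨
    ((i : ℕ) + 1 = m ∧ ((nextIdx i : Fin m) : ℕ) = 0) := by
  rw [nextIdx_val]
  rcases Nat.lt_or_ge ((i : ℕ) + 1) m with h | h
  · left; exact ⟨h, Nat.mod_eq_of_lt h⟩
  · right
    have : (i : ℕ) + 1 = m := by have := i.2; omega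
    exact ⟨this, by rw [this, Nat.mod_self]⟩

theorem nextIdx_inj (m : ℕ) : Function.Injective (nextIdx : Fin m → Fin m) := by
  intro i j hij
  have h1 := nextIdx_cases i
  have h2 := nextIdx_cases j
  have h3 := congrArg Fin.val hij
  apply Fin.ext
  omega

noncomputable def nx (n : ℕ) : Equiv.Perm (Fin n) :=
  Equiv.ofBijective nextIdx (Finite.injective_iff_bijective.1 (nextIdx_inj n))

theorem nx_apply {n : ℕ} (i : Fin n) : nx n i = nextIdx i := rfl

theorem cyc_nx (n : ℕ) : Cyc (nx n) := by
  rintro P ⟨i, hi⟩ hP j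
  have h1 : ∀ k, ∀ j : Fin n, (j : ℕ) = ((i : ℕ) + k) % n → P j := by
    intro k
    induction k with
    | zero =>
      intro j hj
      rw [Nat.add_zero, Nat.mod_eq_of_lt i.2] at hj
      rwa [Fin.ext hj]
    | succ k ih =>
      intro j hj
      have h2 := hP _ (ih ⟨((i : ℕ) + k) % n, Nat.mod_lt _ i.pos⟩ rfl)
      rw [nx_apply] at h2
      convert h2
      apply Fin.ext
      rw [nextIdx_val, hj, Nat.mod_add_mod, add_assoc]
  refine h1 (j + n - i) j ?_
  rw [show (i : ℕ) + (j + n - i) = j + n by have := i.2; omega, Nat.add_mod_right, Nat.mod_eq_of_lt j.2]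

theorem split_lt {n : ℕ} (a b : Fin n) (hab : a < b) : ∃ s' : Equiv.Perm (Fin n),
    s' b = a ∧ ∀ k, k ≠ b → s' k = nx n k ∨ s' k = k := by
  let f : Fin n → Fin n := fun k => if k = b then a else if a ≤ k ∧ k < b then nextIdx k else k
  have hf : Function.Injective f := by
    intro i j hij
    have h1 := nextIdx_cases i
    have h2 := nextIdx_cases j
    have h3 := congrArg Fin.val hij
    simp only [f] at h3
    apply Fin.ext
    have hbn := b.2
    simp only [Fin.ext_iff, Fin.le_def, Fin.lt_def] at h3 hab
    split_ifs at h3 <;> omega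
  refine ⟨Equiv.ofBijective f (Finite.injective_iff_bijective.1 hf), ?_, ?_⟩
  · exact if_pos rfl
  · intro k hk
    have : f k = if a ≤ k ∧ k < b then nextIdx k else k := if_neg hk
    rw [Equiv.ofBijective_apply, this]
    split_ifs
    · left; rfl
    · right; rfl

theorem hsplit_nx (n : ℕ) : HSplit (nx n) := by
  intro a b hab
  rcases lt_or_gt_of_ne hab with h | h
  · obtain ⟨s', h1⟩ := split_lt a b h
    exact ⟨s', Or.inl h1⟩
  · obtain ⟨s', h1⟩ := split_lt b a h
    exact ⟨s', Or.inr h1⟩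

theorem exists_eps {n : ℕ} (hn : 0 < n) (X : Fin n → ℝ) (hX : Function.Injective X) :
    ∃ ε > 0, ∀ i j, i ≠ j → 4 * ε < |X i - X j| := by
  have : Nonempty (Fin n × Fin n) := ⟨⟨⟨0, hn⟩, ⟨0, hn⟩⟩⟩
  obtain ⟨p, hp⟩ := Finite.exists_min
    (fun p : Fin n × Fin n => if p.1 = p.2 then (1 : ℝ) else |X p.1 - X p.2|)
  have hpos : 0 < (if p.1 = p.2 then (1 : ℝ) else |X p.1 - X p.2|) := by
    split_ifs with h
    · exact one_pos
    · exact abs_pos.2 (sub_ne_zero.2 fun hc => h (hX hc))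
  refine ⟨_, div_pos hpos (by norm_num : (0 : ℝ) < 5), fun i j hij => ?_⟩
  have := hp (i, j)
  simp only [hij, if_false] at this
  linarith

theorem seg_h {p q : ℝ × ℝ} (h : q.2 = p.2) (z : ℝ × ℝ) :
    z ∈ segment ℝ p q ↔ z.2 = p.2 ∧ z.1 ∈ uIcc p.1 q.1 := by
  obtain ⟨a, y⟩ := p
  obtain ⟨b, y'⟩ := q
  obtain ⟨u, w⟩ := z
  dsimp only at h
  subst h
  rw [← Prod.image_mk_segment_left, segment_eq_uIcc]
  constructor
  · rintro ⟨t, ht, he⟩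
    rw [Prod.mk.injEq] at he
    exact ⟨he.2.symm, he.1 ▸ ht⟩
  · rintro ⟨h1, h2⟩
    exact ⟨u, h2, Prod.ext rfl h1.symm⟩

theorem seg_v {p q : ℝ × ℝ} (h : q.1 = p.1) (z : ℝ × ℝ) :
    z ∈ segment ℝ p q ↔ z.1 = p.1 ∧ z.2 ∈ uIcc p.2 q.2 := by
  obtain ⟨a, y⟩ := p
  obtain ⟨b, y'⟩ := q
  obtain ⟨u, w⟩ := z
  dsimp only at h
  subst h
  rw [← Prod.image_mk_segment_right, segment_eq_uIcc]
  constructor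
  · rintro ⟨t, ht, he⟩
    rw [Prod.mk.injEq] at he
    exact ⟨he.1.symm, he.2 ▸ ht⟩
  · rintro ⟨h1, h2⟩
    exact ⟨w, h2, Prod.ext h1.symm rfl⟩

def ev {n : ℕ} (i : Fin n) : Fin (2 * n) := ⟨2 * i, by have := i.2; omega⟩
def od {n : ℕ} (i : Fin n) : Fin (2 * n) := ⟨2 * i + 1, by have := i.2; omega⟩

theorem next_ev {n : ℕ} (i : Fin n) : nextIdx (ev i) = od i := by
  apply Fin.ext
  have := nextIdx_cases (ev i)
  have := i.2
  simp only [ev, od] at *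
  omega

theorem next_od {n : ℕ} (i : Fin n) : nextIdx (od i) = ev (nx n i) := by
  apply Fin.ext
  have := nextIdx_cases (od i)
  have := nextIdx_cases i
  have := i.2
  simp only [ev, od, nx_apply] at *
  omega

theorem ev_or_od {n : ℕ} (k : Fin (2 * n)) : ∃ i, k = ev i ∨ k = od i := by
  refine ⟨⟨k / 2, by have := k.2; omega⟩, ?_⟩
  simp only [Fin.ext_iff, ev, od]
  omega

theorem main_pack {n : ℕ} {v : Fin (2 * n) → ℝ × ℝ} (hP : IsSimpleRectPolygon n v) :
    Pack (Fin n) (boundedRegion (polyBoundary v)) := by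
  obtain ⟨hn, hh, hv, hx, hy, -, hdis, -⟩ := hP
  have mev : ∀ i : Fin n, ((ev i : Fin (2 * n)) : ℕ) % 2 = 0 := fun i => by simp only [ev]; omega
  have mod' : ∀ i : Fin n, ((od i : Fin (2 * n)) : ℕ) % 2 = 1 := fun i => by simp only [od]; omega
  have ej : ∀ i j : Fin n, ev i = ev j → i = j := by
    intro i j h; simp only [Fin.ext_iff, ev] at *; omega
  have oj : ∀ i j : Fin n, od i = od j → i = j := by
    intro i j h; simp only [Fin.ext_iff, od] at *; omega
  have eo : ∀ i j : Fin n, ev i ≠ od j := by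
    intro i j h; simp only [Fin.ext_iff, ev, od] at h; omega
  let X : Fin n → ℝ := fun i => (v (ev i)).1
  let Y : Fin n → ℝ := fun i => (v (ev i)).2
  have o2 : ∀ i, (v (od i)).2 = Y i := fun i => by
    have := (hh (ev i) (mev i)).1
    rwa [next_ev] at this
  have o1 : ∀ i, (v (od i)).1 = X (nx n i) := fun i => by
    have := (hv (od i) (mod' i)).1
    rw [next_od] at this
    exact this.symm
  have hne : ∀ i, nx n i ≠ i := fun i hc => by
    have := (hh (ev i) (mev i)).2
    rw [next_ev, o1, hc] at this
    exact this rfl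
  have hXi : Function.Injective X := by
    intro i j hij
    obtain ⟨i, rfl⟩ := (nx n).surjective i
    obtain ⟨j, rfl⟩ := (nx n).surjective j
    rw [← o1, ← o1] at hij
    rw [oj _ _ (hx _ _ (mod' i) (mod' j) hij)]
  have hYi : Function.Injective Y := fun i j hij => ej _ _ (hy _ _ (mev i) (mev j) hij)
  have segE : ∀ i z, z ∈ segment ℝ (v (ev i)) (v (nextIdx (ev i))) ↔
      z.2 = Y i ∧ z.1 ∈ uIcc (X i) (X (nx n i)) := by
    intro i z
    rw [next_ev, seg_h (o2 i), o1]
  have segO : ∀ i z, z ∈ segment ℝ (v (od i)) (v (nextIdx (od i))) ↔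
      z.1 = X (nx n i) ∧ z.2 ∈ uIcc (Y i) (Y (nx n i)) := by
    intro i z
    rw [next_od, seg_v (o1 i).symm, o1, o2]
  have hcross : ∀ i j, X (nx n j) ∈ uIcc (X i) (X (nx n i)) → Y i ∈ uIcc (Y j) (Y (nx n j)) →
      j = i ∨ nx n j = i := by
    intro i j h1 h2
    by_contra! hc
    have h3 := hdis (ev i) (od j) (eo i j)
      (by rw [next_ev]; exact fun h => hc.1 (oj _ _ h).symm)
      (by rw [next_od]; exact fun h => hc.2 (ej _ _ h))
    have h4 : (X (nx n j), Y i) ∈ segment ℝ (v (ev i)) (v (nextIdx (ev i))) ∩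
        segment ℝ (v (od j)) (v (nextIdx (od j))) :=
      ⟨(segE _ _).2 ⟨rfl, h1⟩, (segO _ _).2 ⟨rfl, h2⟩⟩
    rw [h3] at h4
    exact h4
  have hB : polyBoundary v = bdry (nx n) X Y := by
    ext z
    unfold polyBoundary bdry
    rw [mem_iUnion]
    constructor
    · rintro ⟨k, hk⟩
      obtain ⟨i, rfl | rfl⟩ := ev_or_od k
      · exact ⟨i, Or.inl ((segE _ _).1 hk)⟩
      · exact ⟨i, Or.inr ((segO _ _).1 hk)⟩
    · rintro ⟨i, hi | hi⟩
      · exact ⟨ev i, (segE _ _).2 hi⟩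
      · exact ⟨od i, (segO _ _).2 hi⟩
  obtain ⟨ε1, p1, g1⟩ := exists_eps hn X hXi
  obtain ⟨ε2, p2, g2⟩ := exists_eps hn Y hYi
  have hRP : RP (nx n) X Y (min ε1 ε2) :=
    { eps := lt_min p1 p2
      gapX := fun i j hij => lt_of_le_of_lt (by linarith [min_le_left ε1 ε2]) (g1 i j hij)
      gapY := fun i j hij => lt_of_le_of_lt (by linarith [min_le_right ε1 ε2]) (g2 i j hij)
      ne := hne
      cross := hcross }
  have : Nonempty (Fin n) := ⟨⟨0, hn⟩⟩
  rw [hB]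
  exact hRP.pack (cyc_nx n) (hsplit_nx n) (Fintype.card_fin n)

end RPoly

theorem stmt13 (n : ℕ) (v : Fin (2 * n) → ℝ × ℝ) (hP : IsSimpleRectPolygon n v) :
    ∃ c d : Fin n → ℝ × ℝ,
      (∀ i, (c i).1 ≠ (d i).1 ∧ (c i).2 ≠ (d i).2) ∧
      boundedRegion (polyBoundary v) = ⋃ i, rect (c i) (d i) ∧
      ∀ i j, i ≠ j → interior (rect (c i) (d i)) ∩ interior (rect (c j) (d j)) = ∅ := by
  obtain ⟨c, d, h1, h2, h3⟩ := RPoly.main_pack hP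
  have hr : ∀ i, rect (c i) (d i) = Set.Icc (c i).1 (d i).1 ×ˢ Set.Icc (c i).2 (d i).2 := by
    intro i
    unfold rect
    rw [min_eq_left (h1 i).1.le, max_eq_right (h1 i).1.le, min_eq_left (h1 i).2.le,
      max_eq_right (h1 i).2.le]
  refine ⟨c, d, fun i => ⟨(h1 i).1.ne, (h1 i).2.ne⟩, ?_, ?_⟩
  · simp only [hr]
    exact h2
  · intro i j hij
    rw [hr, hr, interior_prod_eq, interior_prod_eq, interior_Icc, interior_Icc, interior_Icc,
      interior_Icc, Set.eq_empty_iff_forall_notMem]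
    rintro ⟨x, y⟩ ⟨hi, hj⟩
    exact h3 i j hij x y hi.1 hi.2 hj.1 hj.2
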